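/- arXiv:2106.08583 — 2 statements merged into one kernel-verified Lean document; each statement's English description precedes it below -/
import Mathlib

section
/- Let R be a Cohen–Macaulay local ring of dimension d ≥ 2, 1 ≤ n ≤ d−1, and 0 ≤ t ≤ d+2. Let M be a finitely generated R-module such that M_p has finite projective dimension over R_p for every prime p of height at most n, Ext^j_R(M,M) = 0 for all n ≤ j ≤ d−1, Ext^i_R(M,R) = 0 for all 1 ≤ i ≤ 2d−t+1, and Ext^i_R(Tr M, R) = 0 for all 1 ≤ i ≤ t. Then M is free. -/
open CategoryTheory TensorProduct IsLocalRing

noncomputable section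

/-- The `n`-th Ext group of two `R`-modules. -/
abbrev extGroup (R : Type) [CommRing R] (n : ℕ) (M N : Type) [AddCommGroup M] [Module R M]
    [AddCommGroup N] [Module R N] : Type :=
  ((Ext R (ModuleCat R) n).obj (Opposite.op (ModuleCat.of R M))).obj (ModuleCat.of R N)

/-- The `n`-th Tor group of two `R`-modules. -/
abbrev torGroup (R : Type) [CommRing R] (n : ℕ) (M N : Type) [AddCommGroup M] [Module R M]
    [AddCommGroup N] [Module R N] : Type :=
  ((Tor (ModuleCat R) n).obj (ModuleCat.of R M)).obj (ModuleCat.of R N)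

/-- The depth of a module over a local ring, as the infimum of the degrees in which
`Ext(k, N)` is nonzero. -/
def moduleDepth (R : Type) [CommRing R] [IsLocalRing R] (N : Type) [AddCommGroup N]
    [Module R N] : ℕ∞ :=
  sInf {n : ℕ∞ | ∃ k : ℕ, n = k ∧
    Nontrivial (extGroup R k (R ⧸ IsLocalRing.maximalIdeal R) N)}

/-- A module is maximal Cohen–Macaulay if `depth M_p = dim R_p` for all `p` in the support. -/
def IsMCM (R : Type) [CommRing R] (M : Type) [AddCommGroup M] [Module R M] : Prop :=
  ∀ p : PrimeSpectrum R, Nontrivial (LocalizedModule p.asIdeal.primeCompl M) →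
    (moduleDepth (Localization.AtPrime p.asIdeal)
        (LocalizedModule p.asIdeal.primeCompl M) : WithBot ℕ∞) =
      ringKrullDim (Localization.AtPrime p.asIdeal)

/-- A local ring is Cohen–Macaulay if its depth equals its Krull dimension. -/
def IsCMLocal (R : Type) [CommRing R] [IsLocalRing R] : Prop :=
  (moduleDepth R R : WithBot ℕ∞) = ringKrullDim R

/-- Injective dimension at most `n`, defined recursively via cosyzygies. -/
def hasInjDimLE (R : Type) [CommRing R] : ℕ → ∀ (M : Type) [AddCommGroup M] [Module R M], Prop
  | 0, M, _, _ => Module.Injective R M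
  | (n+1), M, _, _ => ∃ (I : Type) (_ : AddCommGroup I) (_ : Module R I) (f : M →ₗ[R] I),
      Module.Injective R I ∧ Function.Injective f ∧
        hasInjDimLE R n (I ⧸ LinearMap.range f)

/-- Projective dimension at most `n`, defined recursively via syzygies. -/
def hasPdLE (R : Type) [CommRing R] : ℕ → ∀ (M : Type) [AddCommGroup M] [Module R M], Prop
  | 0, M, _, _ => Module.Projective R M
  | (n+1), M, _, _ => ∃ (P : Type) (_ : AddCommGroup P) (_ : Module R P) (f : P →ₗ[R] M),
      Module.Projective R P ∧ Function.Surjective f ∧ hasPdLE R n (LinearMap.ker f)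

/-- `ω` is a canonical module of the Cohen–Macaulay local ring `R`: it is finitely generated,
maximal Cohen–Macaulay, of finite injective dimension, and of type one. -/
def IsCanonicalModule (R : Type) [CommRing R] [IsLocalRing R] (ω : Type) [AddCommGroup ω]
    [Module R ω] : Prop :=
  Module.Finite R ω ∧ IsMCM R ω ∧ (∃ n, hasInjDimLE R n ω) ∧
    ∃ d : ℕ, ringKrullDim R = d ∧
      Nonempty (extGroup R d (R ⧸ IsLocalRing.maximalIdeal R) ω ≃ₗ[R]
        (R ⧸ IsLocalRing.maximalIdeal R))

/-- `T` is an Auslander transpose of `M`: the cokernel of the `R`-dual of a minimal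
free presentation of `M`. -/
def IsAuslanderTranspose (R : Type) [CommRing R] [IsLocalRing R] (M T : Type)
    [AddCommGroup M] [Module R M] [AddCommGroup T] [Module R T] : Prop :=
  ∃ (m n : ℕ) (f : (Fin n → R) →ₗ[R] (Fin m → R)),
    LinearMap.range f ≤ (IsLocalRing.maximalIdeal R) • (⊤ : Submodule R (Fin m → R)) ∧
    LinearMap.ker f ≤ (IsLocalRing.maximalIdeal R) • (⊤ : Submodule R (Fin n → R)) ∧
    Nonempty (((Fin m → R) ⧸ LinearMap.range f) ≃ₗ[R] M) ∧
    Nonempty ((Module.Dual R (Fin n → R) ⧸ LinearMap.range f.dualMap) ≃ₗ[R] T)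

end

section MatrixAction

variable {R : Type} [CommRing R] {ι κ l : Type} [Fintype κ] [Fintype l]
variable {Y Y' D : Type} [AddCommGroup Y] [Module R Y] [AddCommGroup Y'] [Module R Y']
  [AddCommGroup D] [Module R D]

/-- The action of a matrix over `R` on vectors with entries in an `R`-module. -/
def act (A : Matrix ι κ R) (Y : Type) [AddCommGroup Y] [Module R Y] : (κ → Y) →ₗ[R] (ι → Y) :=
  LinearMap.pi fun i => ∑ j, A i j • LinearMap.proj j

lemma act_apply (A : Matrix ι κ R) (y : κ → Y) (i : ι) :
    act A Y y i = ∑ j, A i j • y j := by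
  simp [act]

lemma act_self (A : Matrix ι κ R) (y : κ → R) : act A R y = A.mulVec y := by
  ext i
  simp [act_apply, Matrix.mulVec, dotProduct]

lemma act_mul (A : Matrix ι κ R) (B : Matrix κ l R) (y : l → Y) :
    act (A * B) Y y = act A Y (act B Y y) := by
  ext i
  simp only [act_apply, Matrix.mul_apply, Finset.sum_smul, Finset.smul_sum, mul_smul]
  exact Finset.sum_comm

lemma act_zero (y : κ → Y) : act (0 : Matrix ι κ R) Y y = 0 := by
  ext i
  simp [act_apply]

lemma act_add (A B : Matrix ι κ R) (y : κ → Y) : act (A + B) Y y = act A Y y + act B Y y := by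
  ext i
  simp [act_apply, add_smul, Finset.sum_add_distrib]

lemma act_smul_one [DecidableEq κ] (r : R) (y : κ → Y) :
    act (r • (1 : Matrix κ κ R)) Y y = r • y := by
  ext i
  simp [act_apply, Matrix.one_apply, ite_smul]

lemma act_comp (A : Matrix ι κ R) (f : Y →ₗ[R] Y') (y : κ → Y) :
    act A Y' (fun j => f (y j)) = fun i => f (act A Y y i) := by
  ext i
  simp [act_apply]

lemma act_map {S : Type} [CommRing S] [Algebra R S] [Module S Y] [IsScalarTower R S Y]
    (A : Matrix ι κ R) (y : κ → Y) :
    act (A.map (algebraMap R S)) Y y = act A Y y := by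
  ext i
  simp [act_apply]

/-- Exactness of `Y^l → Y^κ → Y^ι` at the middle term. -/
def ExactOn (A : Matrix ι κ R) (B : Matrix κ l R) (Y : Type) [AddCommGroup Y] [Module R Y] :
    Prop :=
  ∀ y : κ → Y, act A Y y = 0 → ∃ w, act B Y w = y

lemma ExactOn.congr {A : Matrix ι κ R} {B : Matrix κ l R} (h : ExactOn A B Y) (e : Y ≃ₗ[R] Y') :
    ExactOn A B Y' := by
  intro y hy
  obtain ⟨w, hw⟩ := h (fun j => e.symm (y j)) (by
    rw [show (fun j => e.symm (y j)) = fun j => (e.symm : Y' →ₗ[R] Y) (y j) from rfl, act_comp, hy]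
    ext; simp)
  refine ⟨fun j => (e : Y →ₗ[R] Y') (w j), ?_⟩
  rw [act_comp, hw]
  ext; simp

lemma ExactOn.pi {A : Matrix ι κ R} {B : Matrix κ l R} (h : ExactOn A B Y) (m : Type) :
    ExactOn A B (m → Y) := by
  intro y hy
  have h1 : ∀ t : m, ∃ w, act B Y w = fun j => y j t := by
    intro t
    apply h
    have := act_comp A (LinearMap.proj t : (m → Y) →ₗ[R] Y) y
    rw [hy] at this
    exact this
  choose w hw using h1
  refine ⟨fun j t => w t j, ?_⟩
  ext i t
  have := act_comp B (LinearMap.proj t : (m → Y) →ₗ[R] Y) (fun j t => w t j)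
  have h2 := congrFun this i
  simp only [LinearMap.proj_apply] at h2
  rw [← h2, show (fun j => w t j) = w t from rfl, hw]

lemma ExactOn.exists_mul_eq {A : Matrix ι κ R} {B : Matrix κ l R} (h : ExactOn A B R) {m : Type}
    [Fintype m] (U : Matrix κ m R) (hU : A * U = 0) : ∃ V : Matrix l m R, U = B * V := by
  have h1 : ∀ t : m, ∃ w, act B R w = fun j => U j t := by
    intro t
    apply h
    ext i
    rw [act_self]
    exact congrFun (congrFun hU i) t
  choose w hw using h1
  refine ⟨fun j t => w t j, ?_⟩
  ext j t
  rw [← congrFun (hw t) j, act_self]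
  rfl

section Shift

variable {f : Y' →ₗ[R] D} {g : D →ₗ[R] Y} {a b c e : Type} [Fintype b] [Fintype c]
  [Fintype e] {A : Matrix a b R} {B : Matrix b c R} {C : Matrix c e R}

lemma exists_lift_vec (hg : Function.Surjective g) (y : a → Y) :
    ∃ z : a → D, (fun i => g (z i)) = y := by
  choose z hz using fun i => hg (y i)
  exact ⟨z, funext hz⟩

lemma exists_lift_vec_of_exact (hfg : Function.Exact f g) (y : a → D) (hy : (fun i => g (y i)) = 0) :
    ∃ z : a → Y', (fun i => f (z i)) = y := by
  choose z hz using fun i => (hfg (y i)).1 (congrFun hy i)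
  exact ⟨z, funext hz⟩

lemma vec_injective (hf : Function.Injective f) {y z : a → Y'}
    (h : (fun i => f (y i)) = fun i => f (z i)) : y = z :=
  funext fun i => hf (congrFun h i)

lemma vec_eq_zero (hf : Function.Injective f) {y : a → Y'}
    (h : (fun i => f (y i)) = 0) : y = 0 :=
  funext fun i => hf (by rw [Pi.zero_apply, map_zero]; exact congrFun h i)

lemma ExactOn.right (hf : Function.Injective f) (hfg : Function.Exact f g)
    (hg : Function.Surjective g) (hAB : A * B = 0) (h : ExactOn A B Y') (hD : ExactOn B C D) :
    ExactOn B C Y := by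
  intro y hy
  obtain ⟨z, rfl⟩ := exists_lift_vec hg y
  rw [act_comp] at hy
  obtain ⟨u, hu⟩ := exists_lift_vec_of_exact hfg _ hy
  obtain ⟨v, rfl⟩ := h u (vec_eq_zero hf (by
    rw [← act_comp, hu, ← act_mul, hAB, act_zero]))
  obtain ⟨w, hw⟩ := hD (z - fun i => f (v i)) (by
    rw [map_sub, act_comp, hu, sub_self])
  refine ⟨fun i => g (w i), ?_⟩
  rw [act_comp, hw]
  ext i
  simp [hfg.apply_apply_eq_zero]

lemma ExactOn.left (hf : Function.Injective f) (hfg : Function.Exact f g)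
    (hg : Function.Surjective g) (hBC : B * C = 0) (h : ExactOn B C Y)
    (hD : ExactOn A B D) : ExactOn A B Y' := by
  intro y hy
  obtain ⟨z, hz⟩ := hD (fun i => f (y i)) (by rw [act_comp, hy]; ext; simp)
  obtain ⟨u, hu⟩ := h (fun i => g (z i)) (by
    rw [act_comp, hz]; ext; simp [hfg.apply_apply_eq_zero])
  obtain ⟨u, rfl⟩ := exists_lift_vec hg u
  obtain ⟨w, hw⟩ := exists_lift_vec_of_exact hfg (z - act C D u) (by
    rw [act_comp] at hu
    ext i
    simp [congrFun hu i])
  refine ⟨w, vec_injective hf ?_⟩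
  rw [← act_comp, hw, map_sub, hz, ← act_mul, hBC, act_zero, sub_zero]

end Shift

end MatrixAction

/-- A complex of finite free modules in nonnegative degrees, given by its matrices. -/
structure MatComplex (R : Type) [CommRing R] where
  /-- The ranks of the free modules. -/
  rk : ℕ → ℕ
  /-- The differentials. -/
  d : ∀ i, Matrix (Fin (rk i)) (Fin (rk (i + 1))) R
  d_comp : ∀ i, d i * d (i + 1) = 0

namespace MatComplex

variable {R : Type} [CommRing R] (C : MatComplex R)
variable {Y Y' D : Type} [AddCommGroup Y] [Module R Y] [AddCommGroup Y'] [Module R Y']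
  [AddCommGroup D] [Module R D]

lemma d_comp_transpose (i : ℕ) : (C.d (i + 1)).transpose * (C.d i).transpose = 0 := by
  rw [← Matrix.transpose_mul, C.d_comp, Matrix.transpose_zero]

/-- Exactness of `C ⊗ Y` in degree `i + 1`. -/
def TorVanish (i : ℕ) (Y : Type) [AddCommGroup Y] [Module R Y] : Prop :=
  ExactOn (C.d i) (C.d (i + 1)) Y

/-- Exactness of `Hom(C, Y)` in degree `i + 1`. -/
def ExtVanish (i : ℕ) (Y : Type) [AddCommGroup Y] [Module R Y] : Prop :=
  ExactOn (C.d (i + 1)).transpose (C.d i).transpose Y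

/-- The complex without its term in degree zero. -/
def tail : MatComplex R where
  rk i := C.rk (i + 1)
  d i := C.d (i + 1)
  d_comp i := C.d_comp (i + 1)

/-- The ranks of the complex extended by one free module. -/
def consRk (c : ℕ) : ℕ → ℕ
  | 0 => c
  | i + 1 => C.rk i

/-- The differentials of the complex extended by one matrix. -/
def consD {c : ℕ} (J : Matrix (Fin c) (Fin (C.rk 0)) R) :
    ∀ i, Matrix (Fin (C.consRk c i)) (Fin (C.consRk c (i + 1))) R
  | 0 => J
  | i + 1 => C.d i

/-- The complex extended by one matrix in degree zero. -/
def cons {c : ℕ} (J : Matrix (Fin c) (Fin (C.rk 0)) R) (h : J * C.d 0 = 0) : MatComplex R where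
  rk := C.consRk c
  d := C.consD J
  d_comp
    | 0 => h
    | i + 1 => C.d_comp i

/-- The complex obtained by applying a ring homomorphism to all matrices. -/
def map {S : Type} [CommRing S] (φ : R →+* S) : MatComplex S where
  rk := C.rk
  d i := (C.d i).map φ
  d_comp i := by
    rw [← Matrix.map_mul, C.d_comp]
    ext
    simp

/-- The cokernel of the `i`-th differential. -/
abbrev Coker (i : ℕ) : Type := (Fin (C.rk i) → R) ⧸ LinearMap.range (act (C.d i) R)

/-- Multiplication by `r` is null-homotopic in degree `i + 1`. -/
def Kills (r : R) (i : ℕ) : Prop :=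
  ∃ (σ' : Matrix (Fin (C.rk (i + 2))) (Fin (C.rk (i + 1))) R)
    (σ : Matrix (Fin (C.rk (i + 1))) (Fin (C.rk i)) R),
    r • (1 : Matrix (Fin (C.rk (i + 1))) (Fin (C.rk (i + 1))) R) =
      C.d (i + 1) * σ' + σ * C.d i

/-- The ideal of elements `r` for which `r • d i` factors as `d i * σ * d i`. -/
def splitIdeal (i : ℕ) : Ideal R where
  carrier := {r | ∃ σ : Matrix (Fin (C.rk (i + 1))) (Fin (C.rk i)) R, r • C.d i = C.d i * σ * C.d i}
  zero_mem' := ⟨0, by simp⟩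
  add_mem' := by
    rintro a b ⟨σ, hσ⟩ ⟨τ, hτ⟩
    exact ⟨σ + τ, by rw [add_smul, hσ, hτ, Matrix.mul_add, Matrix.add_mul]⟩
  smul_mem' := by
    rintro c a ⟨σ, hσ⟩
    exact ⟨c • σ, by rw [smul_eq_mul, mul_smul, hσ, Matrix.mul_smul, Matrix.smul_mul]⟩

variable {C}

lemma Kills.mem_splitIdeal {r : R} {i : ℕ} (h : C.Kills r i) : r ∈ C.splitIdeal i := by
  obtain ⟨σ', σ, h⟩ := h
  refine ⟨σ, ?_⟩
  have := congrArg (C.d i * ·) h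
  simpa [Matrix.mul_add, ← Matrix.mul_assoc, C.d_comp] using this

lemma Kills.mem_splitIdeal_succ {r : R} {i : ℕ} (h : C.Kills r i) : r ∈ C.splitIdeal (i + 1) := by
  obtain ⟨σ', σ, h⟩ := h
  refine ⟨σ', ?_⟩
  have := congrArg (· * C.d (i + 1)) h
  simpa [Matrix.add_mul, Matrix.mul_assoc, C.d_comp] using this

lemma kills_of_mem_splitIdeal {r : R} {i : ℕ} (h : r ∈ C.splitIdeal i) (hC : C.TorVanish i R) :
    C.Kills r i := by
  obtain ⟨σ, hσ⟩ := h
  obtain ⟨σ', h'⟩ := hC.exists_mul_eq (r • (1 : Matrix _ _ R) - σ * C.d i) (by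
    rw [Matrix.mul_sub, ← Matrix.mul_assoc, ← hσ]; simp)
  exact ⟨σ', σ, by rw [← h']; simp⟩

lemma kills_of_mem_splitIdeal_succ {r : R} {i : ℕ} (h : r ∈ C.splitIdeal (i + 1))
    (hC : C.ExtVanish i R) : C.Kills r i := by
  obtain ⟨σ, hσ⟩ := h
  obtain ⟨τ, hτ⟩ := hC.exists_mul_eq (r • (1 : Matrix _ _ R) - C.d (i + 1) * σ).transpose (by
    rw [← Matrix.transpose_mul, Matrix.sub_mul, ← hσ]; simp)
  refine ⟨σ, τ.transpose, ?_⟩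
  have := congrArg Matrix.transpose hτ
  rw [Matrix.transpose_transpose, Matrix.transpose_mul, Matrix.transpose_transpose] at this
  rw [← this]
  simp

lemma mem_splitIdeal_of_le {r : R} {i k : ℕ} (hik : i ≤ k) (h : r ∈ C.splitIdeal i)
    (hC : ∀ j, i ≤ j → C.TorVanish j R) : r ∈ C.splitIdeal k := by
  induction k, hik using Nat.le_induction with
  | base => exact h
  | succ k hk ih => exact (kills_of_mem_splitIdeal ih (hC k hk)).mem_splitIdeal_succ

lemma mem_splitIdeal_of_ge {r : R} {i k : ℕ} (hik : i ≤ k) (h : r ∈ C.splitIdeal k)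
    (hC : ∀ j, i ≤ j → j < k → C.ExtVanish j R) : r ∈ C.splitIdeal i := by
  induction k, hik using Nat.le_induction with
  | base => exact h
  | succ k hk ih =>
    exact ih (kills_of_mem_splitIdeal_succ h (hC k hk (by omega))).mem_splitIdeal
      fun j hj hj' => hC j hj (by omega)

lemma Kills.exists_smul_eq {r : R} {i : ℕ} (h : C.Kills r i) (y : Fin (C.rk (i + 1)) → Y)
    (hy : act (C.d i) Y y = 0) : ∃ w, act (C.d (i + 1)) Y w = r • y := by
  obtain ⟨σ', σ, h⟩ := h
  refine ⟨act σ' Y y, ?_⟩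
  rw [← act_smul_one, h, act_add, act_mul, act_mul, hy, map_zero, add_zero]

lemma Kills.exists_smul_eq_transpose {r : R} {i : ℕ} (h : C.Kills r i)
    (y : Fin (C.rk (i + 1)) → Y) (hy : act (C.d (i + 1)).transpose Y y = 0) :
    ∃ w, act (C.d i).transpose Y w = r • y := by
  obtain ⟨σ', σ, h⟩ := h
  refine ⟨act σ.transpose Y y, ?_⟩
  rw [← act_smul_one, ← Matrix.transpose_one, ← Matrix.transpose_smul, h, Matrix.transpose_add,
    act_add, Matrix.transpose_mul, Matrix.transpose_mul, act_mul, act_mul, hy, map_zero, zero_add]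

lemma Kills.succ {r : R} {i : ℕ} (h : C.Kills r i) (hC : C.TorVanish (i + 1) R) :
    C.Kills r (i + 1) :=
  kills_of_mem_splitIdeal h.mem_splitIdeal_succ hC

section Shift

variable {f : Y' →ₗ[R] D} {g : D →ₗ[R] Y}

lemma TorVanish.right {i : ℕ} (hf : Function.Injective f) (hfg : Function.Exact f g)
    (hg : Function.Surjective g) (h : C.TorVanish i Y') (hD : C.TorVanish (i + 1) D) :
    C.TorVanish (i + 1) Y :=
  ExactOn.right hf hfg hg (C.d_comp i) h hD

lemma ExtVanish.right {i : ℕ} (hf : Function.Injective f) (hfg : Function.Exact f g)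
    (hg : Function.Surjective g) (h : C.ExtVanish (i + 1) Y') (hD : C.ExtVanish i D) :
    C.ExtVanish i Y :=
  ExactOn.right hf hfg hg (C.d_comp_transpose (i + 1)) h hD

lemma ExtVanish.left {i : ℕ} (hf : Function.Injective f) (hfg : Function.Exact f g)
    (hg : Function.Surjective g) (h : C.ExtVanish i Y) (hD : C.ExtVanish (i + 1) D) :
    C.ExtVanish (i + 1) Y' :=
  ExactOn.left hf hfg hg (C.d_comp_transpose i) h hD

end Shift

/-- The identity of `D` lies in `I • End D`. -/
def _root_.IsDivisibleBy (I : Ideal R) (D : Type) [AddCommGroup D] [Module R D] : Prop :=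
  (1 : Module.End R D) ∈ I • (⊤ : Submodule R (Module.End R D))

lemma _root_.IsDivisibleBy.pow_smul_eq_top {I : Ideal R} (h : IsDivisibleBy I D) (n : ℕ) :
    I ^ n • (⊤ : Submodule R (Module.End R D)) = ⊤ := by
  have h1 : I • (⊤ : Submodule R (Module.End R D)) = ⊤ := by
    rw [eq_top_iff]
    intro φ _
    have := Submodule.mem_map_of_mem (f := LinearMap.mulRight R φ) h
    rw [Submodule.map_smul''] at this
    simpa using smul_mono_right I (le_top (a := Submodule.map _ ⊤)) this
  induction n with
  | zero => simp
  | succ n ih => rw [pow_succ, Submodule.mul_smul, h1, ih]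

lemma _root_.IsDivisibleBy.exists_act_eq {I : Ideal R} (h : IsDivisibleBy I D) {n : ℕ} {ι κ : Type}
    [Fintype κ] (B : Matrix ι κ R) (y : ι → D)
    (hy : ∀ r ∈ I ^ n, ∀ φ : Module.End R D, ∃ w, act B D w = r • fun i => φ (y i)) :
    ∃ w, act B D w = y := by
  have h1 : (1 : Module.End R D) ∈ I ^ n • (⊤ : Submodule R (Module.End R D)) := by
    rw [h.pow_smul_eq_top]; trivial
  let ev : Module.End R D →ₗ[R] (ι → D) := LinearMap.pi fun i => LinearMap.applyₗ (y i)
  have h2 : I ^ n • (⊤ : Submodule R (Module.End R D)) ≤ (LinearMap.range (act B D)).comap ev := by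
    rw [Submodule.smul_le]
    intro r hr φ _
    obtain ⟨w, hw⟩ := hy r hr φ
    exact ⟨w, by rw [hw, map_smul]; rfl⟩
  exact h2 h1

lemma TorVanish.of_isDivisibleBy {I : Ideal R} (h : IsDivisibleBy I D) {n i : ℕ}
    (hI : ∀ r ∈ I ^ n, C.Kills r i) : C.TorVanish i D := fun y hy =>
  h.exists_act_eq _ y fun r hr φ => (hI r hr).exists_smul_eq _ (by
    rw [act_comp, hy]; ext; simp)

lemma ExtVanish.of_isDivisibleBy {I : Ideal R} (h : IsDivisibleBy I D) {n i : ℕ}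
    (hI : ∀ r ∈ I ^ n, C.Kills r i) : C.ExtVanish i D := fun y hy =>
  h.exists_act_eq _ y fun r hr φ => (hI r hr).exists_smul_eq_transpose _ (by
    rw [act_comp, hy]; ext; simp)

end MatComplex

section Resolution

variable {R : Type} [CommRing R]

lemma mem_span_range_iff_exists_act {ι : Type} {m : ℕ} (s : Fin m → ι → R) (x : ι → R) :
    x ∈ Submodule.span R (Set.range s) ↔
      ∃ w, act (Matrix.of fun i j => s j i) R w = x := by
  rw [Submodule.mem_span_range_iff_exists_fun]
  refine exists_congr fun c => ?_
  rw [show act (Matrix.of fun i j => s j i) R c = ∑ i, c i • s i by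
    ext i; simp [act_apply, mul_comm]]

variable [IsNoetherianRing R]

lemma exists_ker_matrix {a b : ℕ} (A : Matrix (Fin a) (Fin b) R) :
    ∃ (c : ℕ) (B : Matrix (Fin b) (Fin c) R), A * B = 0 ∧ ExactOn A B R := by
  obtain ⟨c, s, hs⟩ := Submodule.fg_iff_exists_fin_generating_family.1
    (IsNoetherian.noetherian (LinearMap.ker (act A R)))
  refine ⟨c, Matrix.of fun i j => s j i, ?_, ?_⟩
  · ext i j
    have : s j ∈ LinearMap.ker (act A R) := hs ▸ Submodule.subset_span ⟨j, rfl⟩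
    have := congrFun (LinearMap.mem_ker.1 this) i
    rw [act_self] at this
    exact this
  · intro y hy
    rw [← mem_span_range_iff_exists_act, hs]
    exact hy

/-- The number of generators chosen for the kernel of a matrix. -/
noncomputable def kerRk {a b : ℕ} (A : Matrix (Fin a) (Fin b) R) : ℕ :=
  (exists_ker_matrix A).choose

/-- A matrix whose columns generate the kernel of a given matrix. -/
noncomputable def kerMatrix {a b : ℕ} (A : Matrix (Fin a) (Fin b) R) :
    Matrix (Fin b) (Fin (kerRk A)) R :=
  (exists_ker_matrix A).choose_spec.choose

lemma mul_kerMatrix {a b : ℕ} (A : Matrix (Fin a) (Fin b) R) : A * kerMatrix A = 0 :=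
  (exists_ker_matrix A).choose_spec.choose_spec.1

lemma exactOn_kerMatrix {a b : ℕ} (A : Matrix (Fin a) (Fin b) R) : ExactOn A (kerMatrix A) R :=
  (exists_ker_matrix A).choose_spec.choose_spec.2

/-- The matrices of a free resolution starting with a given matrix. -/
noncomputable def resSeq {a b : ℕ} (A : Matrix (Fin a) (Fin b) R) :
    ℕ → Σ (a b : ℕ), Matrix (Fin a) (Fin b) R
  | 0 => ⟨a, b, A⟩
  | n + 1 => ⟨(resSeq A n).2.1, kerRk (resSeq A n).2.2, kerMatrix (resSeq A n).2.2⟩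

/-- A free resolution of the cokernel of a matrix. -/
noncomputable def res {a b : ℕ} (A : Matrix (Fin a) (Fin b) R) : MatComplex R where
  rk i := (resSeq A i).1
  d i := (resSeq A i).2.2
  d_comp i := mul_kerMatrix (resSeq A i).2.2

lemma torVanish_res {a b : ℕ} (A : Matrix (Fin a) (Fin b) R) (i : ℕ) : (res A).TorVanish i R :=
  exactOn_kerMatrix (resSeq A i).2.2

end Resolution

section ResidueField

variable (A : Type) [CommRing A] [IsNoetherianRing A] [IsLocalRing A]

/-- The number of chosen generators of the maximal ideal. -/
noncomputable def maxRk : ℕ :=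
  (Submodule.fg_iff_exists_fin_generating_family.1
    (IsNoetherian.noetherian (maximalIdeal A))).choose

/-- Chosen generators of the maximal ideal. -/
noncomputable def maxGen : Fin (maxRk A) → A :=
  (Submodule.fg_iff_exists_fin_generating_family.1
    (IsNoetherian.noetherian (maximalIdeal A))).choose_spec.choose

lemma span_maxGen : Ideal.span (Set.range (maxGen A)) = maximalIdeal A :=
  (Submodule.fg_iff_exists_fin_generating_family.1
    (IsNoetherian.noetherian (maximalIdeal A))).choose_spec.choose_spec

/-- The row of generators of the maximal ideal. -/
noncomputable def maxRow : Matrix (Fin 1) (Fin (maxRk A)) A := Matrix.of fun _ j => maxGen A j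

/-- A free resolution of the residue field. -/
noncomputable def fieldRes : MatComplex A := res (maxRow A)

/-- A free resolution of the residue field, shifted up by one degree. -/
noncomputable def kres : MatComplex A :=
  (fieldRes A).cons (0 : Matrix (Fin 0) (Fin ((fieldRes A).rk 0)) A) (Matrix.zero_mul _)

variable {A}

lemma act_maxRow_transpose {Y : Type} [AddCommGroup Y] [Module A Y] (y : Fin 1 → Y)
    (j : Fin (maxRk A)) : act (maxRow A).transpose Y y j = maxGen A j • y 0 := by
  simp [act_apply, maxRow]

lemma forall_mem_maximalIdeal_smul_eq_zero_iff {Y : Type} [AddCommGroup Y] [Module A Y] (y : Y) :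
    (∀ s ∈ maximalIdeal A, s • y = 0) ↔ ∀ j, maxGen A j • y = 0 := by
  constructor
  · intro h j
    exact h _ (span_maxGen A ▸ Ideal.subset_span ⟨j, rfl⟩)
  · intro h s hs
    rw [← span_maxGen A] at hs
    induction hs using Submodule.span_induction with
    | mem x hx => obtain ⟨j, rfl⟩ := hx; exact h j
    | zero => simp
    | add x y _ _ hx hy => rw [add_smul, hx, hy, add_zero]
    | smul a x _ hx => rw [smul_assoc, hx, smul_zero]

lemma kres_extVanish_zero {Y : Type} [AddCommGroup Y] [Module A Y] :
    (kres A).ExtVanish 0 Y ↔ ∀ y : Y, (∀ s ∈ maximalIdeal A, s • y = 0) → y = 0 := by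
  constructor
  · intro h y hy
    rw [forall_mem_maximalIdeal_smul_eq_zero_iff] at hy
    obtain ⟨w, hw⟩ := h (fun _ : Fin 1 => y)
      (funext fun j => (act_maxRow_transpose (fun _ => y) j).trans (hy j))
    have h0 := congrFun hw (0 : Fin 1)
    exact h0.symm.trans ((act_apply (R := A) (κ := Fin 0) _ w _).trans
      (Finset.sum_eq_zero fun i _ => i.elim0))
  · intro h y hy
    refine ⟨0, ?_⟩
    rw [map_zero]
    funext i
    have hi : i = (0 : Fin 1) := Subsingleton.elim (α := Fin 1) _ _
    subst hi
    refine (h _ ((forall_mem_maximalIdeal_smul_eq_zero_iff _).2 fun j => ?_)).symm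
    have := congrFun hy j
    exact (act_maxRow_transpose (A := A) y j).symm.trans this

lemma kres_kills (s : A) (hs : s ∈ maximalIdeal A) (i : ℕ) : (kres A).Kills s i := by
  induction i with
  | zero =>
    rw [← span_maxGen A, Ideal.span, Submodule.mem_span_range_iff_exists_fun] at hs
    obtain ⟨c, hc⟩ := hs
    refine ⟨show Matrix (Fin (maxRk A)) (Fin 1) A from Matrix.of fun j _ => c j, 0, ?_⟩
    rw [Matrix.zero_mul, add_zero]
    change s • (1 : Matrix (Fin 1) (Fin 1) A) =
      maxRow A * (Matrix.of fun j _ => c j : Matrix (Fin (maxRk A)) (Fin 1) A)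
    ext i j
    have : i = j := Subsingleton.elim _ _
    subst this
    simp [Matrix.mul_apply, maxRow, ← hc, mul_comm]
  | succ i ih => exact ih.succ (torVanish_res (maxRow A) i)

lemma kres_extVanish_of_isDivisibleBy {D : Type} [AddCommGroup D] [Module A D]
    (hD : IsDivisibleBy (maximalIdeal A) D) (i : ℕ) : (kres A).ExtVanish i D :=
  MatComplex.ExtVanish.of_isDivisibleBy hD (n := 1) fun r hr => kres_kills r (by simpa using hr) i

lemma kres_eq_zero_of_smul {Y : Type} [AddCommGroup Y] [Module A Y] {i : ℕ} {s : A}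
    (hs : s ∈ maximalIdeal A)
    (hY : ∀ y : Fin ((kres A).rk (i + 1)) → Y, act ((kres A).d (i + 1)).transpose Y y = 0 →
      (∃ w, act ((kres A).d i).transpose Y w = s • y) →
      ∃ w, act ((kres A).d i).transpose Y w = y) : (kres A).ExtVanish i Y :=
  fun y hy => hY y hy ((kres_kills s hs i).exists_smul_eq_transpose y hy)

lemma exists_isDivisibleBy_embedding {Y : Type} [AddCommGroup Y] [Module A Y]
    (hY : (kres A).ExtVanish 0 Y) :
    ∃ (D : Type) (_ : AddCommGroup D) (_ : Module A D) (f : Y →ₗ[A] D),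
      Function.Injective f ∧ IsDivisibleBy (maximalIdeal A) D := by
  classical
  rw [kres_extVanish_zero] at hY
  let D : Fin (maxRk A) → Type := fun j => LocalizedModule (Submonoid.powers (maxGen A j)) Y
  let f : ∀ j, Y →ₗ[A] D j := fun j => LocalizedModule.mkLinearMap _ Y
  refine ⟨∀ j, D j, inferInstance, inferInstance, LinearMap.pi f, ?_, ?_⟩
  · rw [injective_iff_map_eq_zero]
    intro y hy
    have h1 : maximalIdeal A ≤ (Ideal.radical (Submodule.annihilator (Submodule.span A {y}))) := by
      rw [← span_maxGen A, Ideal.span_le]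
      rintro _ ⟨j, rfl⟩
      have hj : f j y = 0 := congrFun hy j
      obtain ⟨⟨_, n, rfl⟩, hn⟩ := (IsLocalizedModule.eq_zero_iff
        (Submonoid.powers (maxGen A j)) (f j)).1 hj
      exact ⟨n, (Submodule.mem_annihilator_span_singleton _ _).2 hn⟩
    obtain ⟨n, hn⟩ := Ideal.exists_pow_le_of_le_radical_of_fg h1
      (IsNoetherian.noetherian (maximalIdeal A))
    have h2 : ∀ n, ∀ y : Y, (∀ r ∈ maximalIdeal A ^ n, r • y = 0) → y = 0 := by
      intro n
      induction n with
      | zero => intro y hy; simpa using hy 1 (by simp)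
      | succ n ih =>
        intro y hy
        refine ih y fun r hr => hY _ fun s hs => ?_
        rw [smul_smul]
        exact hy _ (by rw [pow_succ']; exact Ideal.mul_mem_mul hs hr)
    exact h2 n y fun r hr => (Submodule.mem_annihilator_span_singleton _ _).1 (hn hr)
  · have h1 : ∀ j, ∃ u : Module.End A (D j), maxGen A j • u = 1 := by
      intro j
      obtain ⟨u, hu⟩ := IsLocalizedModule.map_units (S := Submonoid.powers (maxGen A j)) (f j)
        ⟨maxGen A j, Submonoid.mem_powers _⟩
      refine ⟨↑u⁻¹, ?_⟩
      have : algebraMap A (Module.End A (D j)) (maxGen A j) * ↑u⁻¹ = 1 := by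
        rw [← Units.mul_inv u, hu]
      rw [← this, Algebra.smul_def]
    choose u hu using h1
    have h2 : (1 : Module.End A (∀ j, D j)) = ∑ j, maxGen A j •
        (LinearMap.single A D j ∘ₗ u j ∘ₗ LinearMap.proj j) := by
      refine LinearMap.ext fun x => funext fun j => ?_
      rw [LinearMap.sum_apply, Finset.sum_apply, Finset.sum_eq_single j]
      · have := LinearMap.congr_fun (hu j) (x j)
        simpa using this.symm
      · intro b _ hb
        simp [Pi.single_eq_of_ne' hb]
      · simp
    unfold IsDivisibleBy
    rw [h2]
    exact Submodule.sum_mem _ fun j _ => Submodule.smul_mem_smul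
      (span_maxGen A ▸ Ideal.subset_span ⟨j, rfl⟩) trivial

end ResidueField

namespace MatComplex

section Syz

variable {R : Type} [CommRing R] (C : MatComplex R)
variable {Y Y' D : Type} [AddCommGroup Y] [Module R Y] [AddCommGroup Y'] [Module R Y']
  [AddCommGroup D] [Module R D]

/-- The image of the `k`-th differential of `C ⊗ Y`. -/
abbrev syz (k : ℕ) (Y : Type) [AddCommGroup Y] [Module R Y] :
    Submodule R (Fin (C.rk k) → Y) := LinearMap.range (act (C.d k) Y)

/-- The map on images of differentials induced by a linear map. -/
def syzMap (k : ℕ) (f : Y' →ₗ[R] Y) : C.syz k Y' →ₗ[R] C.syz k Y :=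
  (f.compLeft (Fin (C.rk k))).restrict (by
    rintro _ ⟨w, rfl⟩
    exact ⟨fun i => f (w i), act_comp _ _ _⟩)

variable {C} {f : Y' →ₗ[R] D} {g : D →ₗ[R] Y} {k : ℕ}

lemma syzMap_injective (hf : Function.Injective f) : Function.Injective (C.syzMap k f) := by
  intro x y hxy
  ext i
  exact hf (congrFun (congrArg Subtype.val hxy) i)

lemma syzMap_surjective (hg : Function.Surjective g) : Function.Surjective (C.syzMap k g) := by
  rintro ⟨_, w, rfl⟩
  obtain ⟨z, rfl⟩ := exists_lift_vec hg w
  exact ⟨⟨_, z, rfl⟩, Subtype.ext (act_comp _ _ _).symm⟩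

lemma syzMap_exact (hfg : Function.Exact f g) (hg : Function.Surjective g)
    (hY : C.TorVanish k Y) : Function.Exact (C.syzMap k f) (C.syzMap k g) := by
  rintro ⟨_, u, rfl⟩
  constructor
  · intro h
    obtain ⟨w, hw⟩ := hY (fun i => g (u i)) (by
      rw [act_comp]
      exact congrArg Subtype.val h)
    obtain ⟨w, rfl⟩ := exists_lift_vec hg w
    obtain ⟨v, hv⟩ := exists_lift_vec_of_exact hfg (u - act (C.d (k + 1)) D w) (by
      rw [act_comp] at hw
      ext i
      simp [congrFun hw i])
    refine ⟨⟨_, v, rfl⟩, Subtype.ext ?_⟩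
    change (fun i => f (act (C.d k) Y' v i)) = act (C.d k) D u
    rw [← act_comp, hv, map_sub, ← act_mul, C.d_comp, act_zero, sub_zero]
  · rintro ⟨x, hx⟩
    rw [← hx]
    ext i
    exact hfg.apply_apply_eq_zero _

lemma _root_.IsDivisibleBy.syz {I : Ideal R} (h : IsDivisibleBy I D) (k : ℕ) :
    IsDivisibleBy I (C.syz k D) := by
  let L : Module.End R D →ₗ[R] Module.End R (C.syz k D) :=
    { toFun := fun φ => C.syzMap k φ
      map_add' := fun _ _ => rfl
      map_smul' := fun _ _ => rfl }
  have := Submodule.mem_map_of_mem (f := L) h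
  rw [Submodule.map_smul''] at this
  exact smul_mono_right I (le_top (a := Submodule.map _ ⊤)) this

end Syz

section ModExact

variable {A : Type} [CommRing A] [IsLocalRing A] {C : MatComplex A}

lemma exists_sub_act_mem {ι κ : Type} [Fintype ι] [Fintype κ] (B : Matrix ι κ A) (z : ι → A)
    (hz : ∀ c : ι → A, (∀ j, act B.transpose A c j ∈ maximalIdeal A) →
      ∑ i, z i * c i ∈ maximalIdeal A) :
    ∃ w, ∀ i, z i - act B A w i ∈ maximalIdeal A := by
  classical
  have hB : ∀ (c : κ → A) i, residue A (act B A c i) =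
      act (B.map (residue A)) (ResidueField A) (fun j => residue A (c j)) i := by
    intro c i
    simp [act_apply]
  by_cases h : (fun i => residue A (z i)) ∈ LinearMap.range (act (B.map (residue A)) (ResidueField A))
  · obtain ⟨w, hw⟩ := h
    choose v hv using fun j => residue_surjective (w j)
    obtain rfl : (fun j => residue A (v j)) = w := funext hv
    refine ⟨v, fun i => ?_⟩
    rw [← residue_eq_zero_iff, map_sub, hB, hw, sub_self]
  · obtain ⟨φ, hφ, hle⟩ := Submodule.exists_le_ker_of_notMem h
    choose c hc using fun i => residue_surjective (φ (Pi.single i 1))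
    have hφ' : ∀ x : ι → ResidueField A, φ x = ∑ i, x i * residue A (c i) := by
      intro x
      rw [LinearMap.pi_apply_eq_sum_univ φ x]
      refine Finset.sum_congr rfl fun i _ => ?_
      rw [hc, smul_eq_mul]
      congr 2
      ext j
      simp [Pi.single_apply, eq_comm]
    refine absurd ?_ hφ
    rw [hφ']
    have := hz c fun j => ?_
    · rw [← residue_eq_zero_iff, map_sum] at this
      simpa using this
    · have := hle (LinearMap.mem_range_self _ (Pi.single j 1))
      rw [LinearMap.mem_ker, hφ'] at this
      rw [← residue_eq_zero_iff, ← this, act_apply]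
      simp [act_apply, Pi.single_apply]

lemma exists_retraction_of_le {n : ℕ} (N : Submodule A (Fin n → A)) [Module.Finite A N]
    (hN : ∀ x : N, (∀ i, (x : Fin n → A) i ∈ maximalIdeal A) →
      x ∈ maximalIdeal A • (⊤ : Submodule A N)) :
    ∃ ρ : (Fin n → A) →ₗ[A] N, ρ ∘ₗ N.subtype = LinearMap.id := by
  rw [IsLocalRing.split_injective_iff_lTensor_residueField_injective,
    injective_iff_map_eq_zero]
  intro t ht
  obtain ⟨x, rfl⟩ := TensorProduct.mk_surjective A N (ResidueField A) residue_surjective t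
  rw [TensorProduct.mk_apply, LinearMap.lTensor_tmul] at ht
  rw [← LinearMap.mem_ker]
  have h1 : LinearMap.ker (TensorProduct.mk A (ResidueField A) N 1) = maximalIdeal A • ⊤ :=
    LinearMap.ker_tensorProductMk N (I := maximalIdeal A)
  rw [h1]
  refine hN x fun i => ?_
  have h2 := congrArg (LinearMap.lTensor (ResidueField A) (LinearMap.proj i : (Fin n → A) →ₗ[A] A)) ht
  rw [LinearMap.lTensor_tmul, map_zero] at h2
  have h3 := congrArg (TensorProduct.rid A (ResidueField A)) h2
  rw [TensorProduct.rid_tmul, map_zero, Algebra.smul_def, mul_one] at h3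
  exact (residue_eq_zero_iff _).1 h3
lemma smul_socle_eq_zero_iff {H : Type} [AddCommGroup H] [Module A H] {s : H} (hs : s ≠ 0)
    (hs' : ∀ r ∈ maximalIdeal A, r • s = 0) (r : A) : r • s = 0 ↔ r ∈ maximalIdeal A := by
  refine ⟨fun h => ?_, hs' r⟩
  by_contra hr
  rw [mem_maximalIdeal, mem_nonunits_iff, not_not] at hr
  exact hs (hr.smul_eq_zero.1 h)

/-- Exactness of `C ⊗ A / m`, stated for vectors over `A`. -/
def ModExact (C : MatComplex A) (k : ℕ) : Prop :=
  ∀ z : Fin (C.rk (k + 1)) → A, (∀ i, act (C.d k) A z i ∈ maximalIdeal A) →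
    ∃ w, ∀ i, z i - act (C.d (k + 1)) A w i ∈ maximalIdeal A

lemma ModExact.one_mem {k : ℕ} (h : C.ModExact k) :
    (1 : A) ∈ C.splitIdeal k := by
  classical
  obtain ⟨ρ, hρ⟩ := exists_retraction_of_le (LinearMap.range (act (C.d k) A)) (by
    rintro ⟨_, z, rfl⟩ hx
    obtain ⟨w, hw⟩ := h z hx
    have h1 : (⟨act (C.d k) A z, z, rfl⟩ : LinearMap.range (act (C.d k) A)) =
        ∑ j, (z j - act (C.d (k + 1)) A w j) •
          ⟨act (C.d k) A (Pi.single j 1), _, rfl⟩ := by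
      apply Subtype.ext
      simp only [Submodule.coe_sum, Submodule.coe_smul]
      simp_rw [← map_smul]
      rw [← map_sum]
      have : ∑ j, (z j - act (C.d (k + 1)) A w j) • (Pi.single j 1 : Fin (C.rk (k + 1)) → A) =
          z - act (C.d (k + 1)) A w := by
        ext i
        simp [Pi.single_apply]
      rw [this, map_sub, ← act_mul, C.d_comp, act_zero, sub_zero]
    rw [h1]
    exact Submodule.sum_mem _ fun j _ => Submodule.smul_mem_smul (hw j) trivial)
  choose σ hσ using fun i => (ρ (Pi.single i 1)).2
  have hρσ : ∀ x, (ρ x : Fin (C.rk k) → A) = act (C.d k) A (∑ i, x i • σ i) := by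
    intro x
    conv_lhs => rw [← Finset.univ_sum_single x]
    rw [map_sum, map_sum, Submodule.coe_sum]
    refine Finset.sum_congr rfl fun i _ => ?_
    rw [map_smul, hσ, ← Submodule.coe_smul, ← map_smul, ← Pi.single_smul, smul_eq_mul, mul_one]
  refine ⟨Matrix.of fun a b => σ b a, ?_⟩
  rw [one_smul]
  apply Matrix.ext_of_mulVec_single
  intro j
  rw [← act_self, ← act_self, act_mul, act_mul]
  have h1 := LinearMap.congr_fun hρ ⟨act (C.d k) A (Pi.single j 1), _, rfl⟩
  have h2 := congrArg Subtype.val h1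
  rw [LinearMap.comp_apply, hρσ] at h2
  refine h2.symm.trans (congrArg _ ?_)
  ext i
  simp [act_apply, mul_comm]
lemma modExact_of_socle {H : Type} [AddCommGroup H] [Module A H] {s : H} (hs : s ≠ 0)
    (hs' : ∀ r ∈ maximalIdeal A, r • s = 0) {e : ℕ}
    (hX : C.ExtVanish (e + 1) H) (hM : C.ExtVanish e (C.syz (e + 1) H)) : C.ModExact (e + 1) := by
  intro z hz
  refine exists_sub_act_mem _ _ fun c hc => ?_
  rw [← smul_socle_eq_zero_iff hs hs']
  obtain ⟨Ψ, hΨ⟩ := hX (fun i => c i • s) (by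
    have := act_comp (C.d (e + 1 + 1)).transpose (LinearMap.toSpanSingleton A H s) c
    simp only [LinearMap.toSpanSingleton_apply] at this
    rw [this]
    exact funext fun i => hs' _ (hc i))
  set x := act (C.d (e + 1)) A z with hx
  let u : Fin (C.rk (e + 1)) → C.syz (e + 1) H := fun a => ⟨act (C.d (e + 1)) H fun i => z i • Ψ a,
    LinearMap.mem_range_self _ _⟩
  have hu : ∀ a b, (u a : Fin (C.rk (e + 1)) → H) b = x b • Ψ a := fun a b => by
    have := act_comp (C.d (e + 1)) (LinearMap.toSpanSingleton A H (Ψ a)) z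
    simp only [LinearMap.toSpanSingleton_apply] at this
    exact congrFun this b
  obtain ⟨v, hv⟩ := hM u (by
    funext j
    apply Subtype.ext
    funext b
    rw [act_apply]
    have h1 := congrFun hΨ j
    rw [act_apply] at h1
    simp only [Submodule.coe_sum, Submodule.coe_smul, Finset.sum_apply, Pi.smul_apply, hu]
    simp_rw [smul_comm _ (x b)]
    rw [← Finset.smul_sum, h1]
    simp only [smul_smul, Pi.zero_apply, Submodule.coe_zero]
    exact hs' _ (Ideal.mul_mem_right _ _ (hz b)))
  have h1 : ∑ a, x a • Ψ a = (∑ i, z i * c i) • s := by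
    rw [hx]
    simp only [act_apply, Finset.sum_smul]
    rw [Finset.sum_comm]
    refine Finset.sum_congr rfl fun i _ => ?_
    rw [mul_smul, ← congrFun hΨ i, act_apply, Finset.smul_sum]
    refine Finset.sum_congr rfl fun a _ => ?_
    simp only [smul_smul, smul_eq_mul, Matrix.transpose_apply]
    rw [mul_comm]
  have h2 : ∑ a, x a • Ψ a = ∑ b, act (C.d e) H (v b : Fin (C.rk (e + 1)) → H) b := by
    simp only [← hu, ← hv, act_apply]
    simp only [Submodule.coe_sum, Submodule.coe_smul, Finset.sum_apply, Pi.smul_apply,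
      Matrix.transpose_apply]
    exact Finset.sum_comm
  rw [← h1, h2]
  refine Finset.sum_eq_zero fun b _ => ?_
  obtain ⟨w, hw⟩ := (v b).2
  rw [← hw, ← act_mul, C.d_comp, act_zero]
  rfl

lemma modExact_of_split {H : Type} [AddCommGroup H] [Module A H] {s : H} (hs : s ≠ 0)
    (hs' : ∀ r ∈ maximalIdeal A, r • s = 0) {k : ℕ} (hC : (1 : A) ∈ C.splitIdeal (k + 1))
    (hH : C.TorVanish k H) : C.ModExact k := by
  obtain ⟨σ, hσ⟩ := hC
  rw [one_smul] at hσ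
  intro z hz
  refine ⟨act σ A z, fun i => ?_⟩
  rw [← smul_socle_eq_zero_iff hs hs']
  have hc := fun {ι κ : Type} [Fintype κ] (B : Matrix ι κ A) (c : κ → A) =>
    act_comp B (LinearMap.toSpanSingleton A H s) c
  simp only [LinearMap.toSpanSingleton_apply] at hc
  obtain ⟨y, hy⟩ := hH (fun i => z i • s) (by
    rw [hc]
    exact funext fun i => hs' _ (hz i))
  have h1 : act (C.d (k + 1)) H (act σ H fun i => z i • s) = fun i => z i • s := by
    rw [← hy, ← act_mul, ← act_mul, ← hσ]
  rw [hc, hc] at h1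
  rw [sub_smul, congrFun h1 i, sub_self]

end ModExact

section Local

variable {A : Type} [CommRing A] [IsNoetherianRing A] [IsLocalRing A] {C : MatComplex A}

lemma exists_shifted_module (hC : ∀ i, C.TorVanish i A) {n : ℕ}
    (hI : maximalIdeal A ^ n ≤ C.splitIdeal 0) (h : ℕ)
    (hh : ∀ j < h, (kres A).ExtVanish j A) :
    ∃ (H : Type) (_ : AddCommGroup H) (_ : Module A H),
      (∀ j, (kres A).ExtVanish j H ↔ (kres A).ExtVanish (j + h) A) ∧
      (∀ j, h ≤ j → C.TorVanish j H) ∧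
      (∀ j, C.ExtVanish (j + h) A → C.ExtVanish j H) ∧
      ∀ k, h ≤ k → ∀ j, C.ExtVanish (j + h) (C.syz k A) → C.ExtVanish j (C.syz k H) := by
  have hK : ∀ r ∈ maximalIdeal A ^ n, ∀ i, C.Kills r i := fun r hr i =>
    kills_of_mem_splitIdeal (mem_splitIdeal_of_le (Nat.zero_le i) (hI hr) fun j _ => hC j) (hC i)
  induction h with
  | zero => exact ⟨A, inferInstance, inferInstance, fun j => Iff.rfl, fun j _ => hC j,
      fun j hj => hj, fun k _ j hj => hj⟩
  | succ h ih =>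
    obtain ⟨H, _, _, h1, h2, h3, h4⟩ := ih fun j hj => hh j (by omega)
    obtain ⟨D, _, _, f, hf, hD⟩ := exists_isDivisibleBy_embedding (A := A) (Y := H)
      ((h1 0).2 (by rw [Nat.zero_add]; exact hh h (by omega)))
    let g := (LinearMap.range f).mkQ
    have hg : Function.Surjective g := Submodule.mkQ_surjective _
    have hfg : Function.Exact f g := LinearMap.exact_map_mkQ_range f
    have hT : ∀ j, h + 1 ≤ j → C.TorVanish j (D ⧸ LinearMap.range f) := by
      rintro (_ | j) hj
      · omega
      · exact (h2 j (by omega)).right hf hfg hg (.of_isDivisibleBy hD fun r hr => hK r hr _)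
    refine ⟨D ⧸ LinearMap.range f, inferInstance, inferInstance, fun j => ?_, hT, fun j hj => ?_,
      fun k hk j hj => ?_⟩
    · rw [show j + (h + 1) = j + 1 + h by omega, ← h1]
      exact ⟨fun h => h.left hf hfg hg (kres_extVanish_of_isDivisibleBy hD _),
        fun h => h.right hf hfg hg (kres_extVanish_of_isDivisibleBy hD _)⟩
    · rw [show j + (h + 1) = j + 1 + h by omega] at hj
      exact (h3 _ hj).right hf hfg hg (.of_isDivisibleBy hD fun r hr => hK r hr _)
    · rw [show j + (h + 1) = j + 1 + h by omega] at hj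
      exact (h4 k (by omega) _ hj).right (syzMap_injective hf) (syzMap_exact hfg hg (hT k hk))
        (syzMap_surjective hg) (.of_isDivisibleBy (hD.syz k) fun r hr => hK r hr _)

lemma exists_socle {H : Type} [AddCommGroup H] [Module A H] (hH : ¬ (kres A).ExtVanish 0 H) :
    ∃ s : H, s ≠ 0 ∧ ∀ r ∈ maximalIdeal A, r • s = 0 := by
  rw [kres_extVanish_zero] at hH
  push Not at hH
  obtain ⟨s, hs, hs0⟩ := hH
  exact ⟨s, hs0, hs⟩

end Local

end MatComplex

namespace MatComplex

section Coker

variable {R : Type} [CommRing R] {C : MatComplex R}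

/-- The cokernel of a differential is the image of the previous one if the complex is exact. -/
noncomputable def cokerEquivSyz {i : ℕ} (h : C.TorVanish i R) : C.Coker (i + 1) ≃ₗ[R] C.syz i R :=
  (Submodule.quotEquivOfEq _ _ (by
    ext y
    refine ⟨?_, fun hy => h y hy⟩
    rintro ⟨w, rfl⟩
    rw [LinearMap.mem_ker, ← act_mul, C.d_comp, act_zero])).trans
    (act (C.d i) R).quotKerEquivRange

lemma extVanish_coker_iff {i j : ℕ} (hT : C.TorVanish i R) (hj : C.ExtVanish j R)
    (hj' : C.ExtVanish (j + 1) R) :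
    C.ExtVanish j (C.Coker i) ↔ C.ExtVanish (j + 1) (C.Coker (i + 1)) := by
  have hexact := LinearMap.exact_subtype_mkQ (C.syz i R)
  have hinj : Function.Injective (C.syz i R).subtype := Subtype.val_injective
  have hsurj := Submodule.mkQ_surjective (C.syz i R)
  constructor
  · intro h
    exact ExactOn.congr (ExtVanish.left hinj hexact hsurj h (ExactOn.pi hj' _))
      (cokerEquivSyz hT).symm
  · intro h
    exact ExtVanish.right hinj hexact hsurj (ExactOn.congr h (cokerEquivSyz hT)) (ExactOn.pi hj _)

lemma extVanish_coker_add_iff {i j : ℕ} (s : ℕ) (hT : ∀ i, C.TorVanish i R)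
    (hX : ∀ l ≤ j + s, C.ExtVanish l R) :
    C.ExtVanish j (C.Coker i) ↔ C.ExtVanish (j + s) (C.Coker (i + s)) := by
  induction s with
  | zero => rfl
  | succ s ih =>
    rw [ih fun l hl => hX l (by omega)]
    exact extVanish_coker_iff (hT _) (hX _ (by omega)) (hX _ (by omega))

lemma exists_matrix_of_forall_mem_range {F : Type} [Fintype F] [DecidableEq F] {i : ℕ}
    (ρ : (F → R) →ₗ[R] (Fin (C.rk i) → R))
    (hρ : ∀ x, ρ x ∈ LinearMap.range (act (C.d i) R)) :
    ∃ σ : Matrix (Fin (C.rk (i + 1))) F R, ∀ x, ρ x = act (C.d i * σ) R x := by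
  choose σ hσ using fun j => hρ (Pi.single j 1)
  refine ⟨Matrix.of fun a b => σ b a, fun x => ?_⟩
  rw [act_mul, LinearMap.pi_apply_eq_sum_univ ρ x]
  have : ∀ j, ρ (fun k => if j = k then 1 else 0) = act (C.d i) R (σ j) := by
    intro j
    rw [hσ]
    congr 1
    ext k
    simp [Pi.single_apply, eq_comm]
  simp_rw [this, ← map_smul, ← map_sum]
  congr 1
  ext k
  simp [act_apply, mul_comm]

lemma one_mem_splitIdeal_of_projective {i : ℕ} [Module.Projective R (C.Coker i)] :
    (1 : R) ∈ C.splitIdeal i := by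
  classical
  obtain ⟨s, hs⟩ := Module.projective_lifting_property (LinearMap.range (act (C.d i) R)).mkQ
    LinearMap.id (Submodule.mkQ_surjective _)
  obtain ⟨σ, hσ⟩ := C.exists_matrix_of_forall_mem_range (i := i)
    (LinearMap.id - s ∘ₗ (LinearMap.range (act (C.d i) R)).mkQ) (by
      intro x
      refine (Submodule.Quotient.mk_eq_zero _).1 ?_
      rw [← Submodule.mkQ_apply]
      have := LinearMap.congr_fun hs ((LinearMap.range (act (C.d i) R)).mkQ x)
      simp only [LinearMap.comp_apply, LinearMap.id_apply] at this
      simp only [LinearMap.sub_apply, LinearMap.comp_apply, LinearMap.id_apply, map_sub, this,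
        sub_self])
  refine ⟨σ, ?_⟩
  rw [one_smul]
  apply Matrix.ext_of_mulVec_single
  intro j
  rw [← act_self, ← act_self, act_mul, ← hσ]
  have h0 : (LinearMap.range (act (C.d i) R)).mkQ (act (C.d i) R (Pi.single j 1)) = 0 := by
    rw [← LinearMap.mem_ker, Submodule.ker_mkQ]
    exact LinearMap.mem_range_self _ _
  rw [LinearMap.sub_apply, LinearMap.comp_apply, h0, map_zero, sub_zero, LinearMap.id_apply]

lemma projective_coker_of_one_mem_splitIdeal {i : ℕ} (h : (1 : R) ∈ C.splitIdeal i) :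
    Module.Projective R (C.Coker i) := by
  obtain ⟨σ, hσ⟩ := h
  rw [one_smul] at hσ
  let s : C.Coker i →ₗ[R] (Fin (C.rk i) → R) := (LinearMap.range (act (C.d i) R)).liftQ
    (LinearMap.id - act (C.d i * σ) R) (by
      rintro _ ⟨w, rfl⟩
      rw [LinearMap.mem_ker, LinearMap.sub_apply, ← act_mul, ← hσ, LinearMap.id_apply, sub_self])
  refine Module.Projective.of_split s (LinearMap.range (act (C.d i) R)).mkQ ?_
  refine Submodule.linearMap_qext _ (LinearMap.ext fun x => ?_)
  change (LinearMap.range (act (C.d i) R)).mkQ (x - act (C.d i * σ) R x) = Submodule.Quotient.mk x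
  rw [Submodule.mkQ_apply, Submodule.Quotient.eq, sub_sub_cancel_left, neg_mem_iff, act_mul]
  exact LinearMap.mem_range_self _ _

lemma shortExact_of_linearMap {X Y Z : Type} [AddCommGroup X] [Module R X]
    [AddCommGroup Y] [Module R Y] [AddCommGroup Z] [Module R Z] (f : X →ₗ[R] Y) (g : Y →ₗ[R] Z)
    (hf : Function.Injective f) (hfg : Function.Exact f g) (hg : Function.Surjective g) :
    (ShortComplex.mk (ModuleCat.ofHom f) (ModuleCat.ofHom g)
      (by ext x; exact hfg.apply_apply_eq_zero x)).ShortExact where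
  exact := by
    rw [ShortComplex.ShortExact.moduleCat_exact_iff_function_exact]
    exact hfg
  mono_f := (ModuleCat.mono_iff_injective _).2 hf
  epi_g := (ModuleCat.epi_iff_surjective _).2 hg

lemma _root_.hasPdLE.hasProjectiveDimensionLT {k : ℕ} {M : Type} [AddCommGroup M] [Module R M]
    (h : hasPdLE R k M) : HasProjectiveDimensionLT (ModuleCat.of R M) (k + 1) := by
  induction k generalizing M with
  | zero =>
    have : Module.Projective R M := h
    rw [zero_add, ← projective_iff_hasProjectiveDimensionLT_one]
    infer_instance
  | succ k ih =>
    obtain ⟨P, _, _, f, hP, hf, h⟩ := h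
    have hS := shortExact_of_linearMap (LinearMap.ker f).subtype f Subtype.val_injective
      (LinearMap.exact_subtype_ker_map f) hf
    have : Projective (ModuleCat.of R P) := inferInstance
    have : HasProjectiveDimensionLT (ModuleCat.of R P) (k + 1 + 1) :=
      hasProjectiveDimensionLT_of_ge _ 1 _ (by omega)
    exact hS.hasProjectiveDimensionLT_X₃ (k + 1) (ih h) this

lemma hasProjectiveDimensionLT_coker (hT : ∀ i, C.TorVanish i R) {i k : ℕ}
    (h : HasProjectiveDimensionLT (ModuleCat.of R (C.Coker i)) (k + 1)) :
    Module.Projective R (C.Coker (i + k)) := by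
  induction k generalizing i with
  | zero =>
    rw [zero_add, ← projective_iff_hasProjectiveDimensionLT_one] at h
    exact (IsProjective.iff_projective _).2 h
  | succ k ih =>
    have hS := shortExact_of_linearMap (C.syz i R).subtype (C.syz i R).mkQ Subtype.val_injective
      (LinearMap.exact_subtype_mkQ _) (Submodule.mkQ_surjective _)
    have : Projective (ModuleCat.of R (Fin (C.rk i) → R)) := inferInstance
    have : HasProjectiveDimensionLT (ModuleCat.of R (Fin (C.rk i) → R)) (k + 1) :=
      hasProjectiveDimensionLT_of_ge _ 1 _ (by omega)
    have h1 := hS.hasProjectiveDimensionLT_X₁ (k + 1) this h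
    have e : ModuleCat.of R (C.syz i R) ≅ ModuleCat.of R (C.Coker (i + 1)) :=
      (cokerEquivSyz (hT i)).symm.toModuleIso
    have h2 := hasProjectiveDimensionLT_of_iso e (k + 1)
    rw [show i + (k + 1) = i + 1 + k by omega]
    exact ih h2

end Coker

section Local

variable {A : Type} [CommRing A] [IsNoetherianRing A] [IsLocalRing A] {C : MatComplex A}

lemma one_mem_of_split (hC : ∀ i, C.TorVanish i A) {n : ℕ}
    (hI : maximalIdeal A ^ n ≤ C.splitIdeal 0) {h : ℕ}
    (hh : ∀ j < h, (kres A).ExtVanish j A) (hh' : ¬ (kres A).ExtVanish h A)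
    (hX : ∀ j < h, C.ExtVanish j A) {K : ℕ} (hK : (1 : A) ∈ C.splitIdeal K) :
    (1 : A) ∈ C.splitIdeal 0 := by
  obtain ⟨H, _, _, h1, h2, -, -⟩ := exists_shifted_module hC hI h hh
  obtain ⟨s, hs, hs'⟩ := exists_socle (H := H) (by rwa [h1, zero_add])
  induction K with
  | zero => exact hK
  | succ K ih =>
    by_cases hKh : K < h
    · exact ih (kills_of_mem_splitIdeal_succ hK (hX K hKh)).mem_splitIdeal
    · exact ih (modExact_of_split hs hs' hK (h2 K (by omega))).one_mem

lemma one_mem_of_extVanish_syz (hC : ∀ i, C.TorVanish i A) {n : ℕ}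
    (hI : maximalIdeal A ^ n ≤ C.splitIdeal 0) {h : ℕ}
    (hh : ∀ j < h, (kres A).ExtVanish j A) (hh' : ¬ (kres A).ExtVanish h A) {e : ℕ}
    (hhe : h ≤ e + 1) (hX : ∀ j ≤ e + 1 + h, C.ExtVanish j A)
    (hM : C.ExtVanish (e + h) (C.syz (e + 1) A)) : (1 : A) ∈ C.splitIdeal 0 := by
  obtain ⟨H, _, _, h1, h2, h3, h4⟩ := exists_shifted_module hC hI h hh
  obtain ⟨s, hs, hs'⟩ := exists_socle (H := H) (by rwa [h1, zero_add])
  exact mem_splitIdeal_of_ge (Nat.zero_le _)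
    (modExact_of_socle hs hs' (h3 _ (hX _ le_rfl)) (h4 _ hhe _ hM)).one_mem
    fun j _ hj => hX j (by omega)

lemma one_mem_of_extVanish_coker (hC : ∀ i, C.TorVanish i A) {n : ℕ}
    (hI : maximalIdeal A ^ n ≤ C.splitIdeal 0) {h : ℕ}
    (hh : ∀ j < h, (kres A).ExtVanish j A) (hh' : ¬ (kres A).ExtVanish h A) {d t : ℕ}
    (h2 : 2 ≤ h) (hhd : h ≤ d) (ht : t ≤ d + 2) (hX : ∀ j ≤ 2 * d, C.ExtVanish j A)
    (hM : C.ExtVanish (h + t - 2) (C.Coker t)) : (1 : A) ∈ C.splitIdeal 0 := by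
  obtain ⟨e, rfl⟩ : ∃ e, d = e + 1 := ⟨d - 1, by omega⟩
  refine one_mem_of_extVanish_syz hC hI hh hh' hhd (fun j hj => hX j (by omega))
    (ExactOn.congr ?_ (cokerEquivSyz (hC (e + 1))))
  change C.ExtVanish (e + h) (C.Coker (e + 1 + 1))
  obtain ht | rfl : t ≤ e + 2 ∨ t = e + 3 := by omega
  · have := (extVanish_coker_add_iff (e + 2 - t) hC fun l hl => hX l (by omega)).1 hM
    rwa [show h + t - 2 + (e + 2 - t) = e + h by omega,
      show t + (e + 2 - t) = e + 1 + 1 by omega] at this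
  · refine (extVanish_coker_add_iff 1 hC fun l hl => hX l (by omega)).2 ?_
    rwa [show h + (e + 3) - 2 = e + h + 1 by omega] at hM

end Local

end MatComplex

section Glue

variable {R : Type} [CommRing R]

/-- The matrix `A` starts a complex of length `t` that is exact together with its dual. -/
def DualExact : ℕ → ∀ {a b : ℕ}, Matrix (Fin a) (Fin b) R → Prop
  | 0, _, _, _ => True
  | t + 1, _, b, A => ∃ (c : ℕ) (B : Matrix (Fin b) (Fin c) R),
      A * B = 0 ∧ ExactOn A B R ∧ ExactOn B.transpose A.transpose R ∧ DualExact t B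

namespace MatComplex

lemma dualExact (t : ℕ) (G : MatComplex R) (hT : ∀ i, G.TorVanish i R)
    (hX : ∀ i < t, G.ExtVanish i R) : DualExact t (G.d 0) := by
  induction t generalizing G with
  | zero => trivial
  | succ t ih => exact ⟨_, G.d 1, G.d_comp 0, hT 0, hX 0 (Nat.succ_pos t),
      ih G.tail (fun i => hT (i + 1)) fun i hi => hX (i + 1) (Nat.succ_lt_succ hi)⟩

lemma exists_glue (t : ℕ) (C : MatComplex R) (hT : ∀ i, C.TorVanish i R)
    (h : DualExact t (C.d 0).transpose) :
    ∃ C' : MatComplex R, (∀ i, C'.TorVanish i R) ∧ (∀ i < t, C'.ExtVanish i R) ∧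
      (∀ (i : ℕ) (Y : Type) [AddCommGroup Y] [Module R Y],
        C.ExtVanish i Y → C'.ExtVanish (i + t) Y) ∧
      ∀ i, Nonempty (C'.Coker (i + t) ≃ₗ[R] C.Coker i) := by
  induction t generalizing C with
  | zero => exact ⟨C, hT, fun i hi => absurd hi (Nat.not_lt_zero i), fun i Y _ _ h => h,
      fun i => ⟨LinearEquiv.refl R _⟩⟩
  | succ t ih =>
    obtain ⟨c, B, hAB, hex, hdual, hB⟩ := h
    have hJ : B.transpose * C.d 0 = 0 := by
      rw [← Matrix.transpose_transpose (C.d 0), ← Matrix.transpose_mul, hAB,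
        Matrix.transpose_zero]
    obtain ⟨C', h1, h2, h3, h4⟩ := ih (C.cons B.transpose hJ)
      (fun
        | 0 => hdual
        | i + 1 => hT i) hB
    refine ⟨C', h1, fun i hi => ?_, fun i Y _ _ hY => ?_, fun i => ?_⟩
    · obtain hi | rfl := Nat.lt_succ_iff_lt_or_eq.1 hi
      · exact h2 i hi
      · have := h3 0 R hex
        rwa [zero_add] at this
    · have := h3 (i + 1) Y hY
      rwa [show i + 1 + t = i + (t + 1) by omega] at this
    · have := h4 (i + 1)
      rw [show i + 1 + t = i + (t + 1) by omega] at this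
      exact this

end MatComplex

end Glue

section ExtLink

variable {R : Type} [CommRing R]

lemma ProjectiveResolution.exists_eq_comp {X Y : ModuleCat.{0} R} (P : ProjectiveResolution X)
    (n : ℕ) (h : Subsingleton (((Ext R (ModuleCat R) (n + 1)).obj (Opposite.op X)).obj Y))
    (φ : P.complex.X (n + 1) ⟶ Y) (hφ : P.complex.d (n + 2) (n + 1) ≫ φ = 0) :
    ∃ ψ : P.complex.X n ⟶ Y, P.complex.d (n + 1) n ≫ ψ = φ := by
  have hz := (ModuleCat.isZero_of_subsingleton _).of_iso (P.isoExt (R := R) (n + 1) Y).symm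
  rw [← HomologicalComplex.exactAt_iff_isZero_homology,
    HomologicalComplex.exactAt_iff' _ n (n + 1) (n + 2) (by simp) (by simp),
    ShortComplex.moduleCat_exact_iff] at hz
  obtain ⟨ψ, hψ⟩ := hz φ hφ
  exact ⟨ψ, hψ⟩

lemma ProjectiveResolution.eq_zero {X Y : ModuleCat.{0} R} (P : ProjectiveResolution X)
    (h : Subsingleton (((Ext R (ModuleCat R) 0).obj (Opposite.op X)).obj Y))
    (φ : P.complex.X 0 ⟶ Y) (hφ : P.complex.d 1 0 ≫ φ = 0) : φ = 0 := by
  have hz := (ModuleCat.isZero_of_subsingleton _).of_iso (P.isoExt (R := R) 0 Y).symm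
  rw [← HomologicalComplex.exactAt_iff_isZero_homology,
    HomologicalComplex.exactAt_iff' _ 0 0 1 (by simp) (by simp),
    ShortComplex.moduleCat_exact_iff] at hz
  obtain ⟨ψ, hψ⟩ := hz φ hφ
  rw [← hψ]
  have : P.complex.d 0 0 = 0 := P.complex.shape _ _ (by simp)
  change P.complex.d 0 0 ≫ (show P.complex.X 0 ⟶ Y from ψ) = 0
  rw [this, Limits.zero_comp]

namespace MatComplex

variable (C : MatComplex R)

/-- The chain complex of free modules given by the matrices of `C`. -/
noncomputable def chainComplex : ChainComplex (ModuleCat.{0} R) ℕ :=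
  ChainComplex.of (fun i => ModuleCat.of R (Fin (C.rk i) → R))
    (fun i => ModuleCat.ofHom (act (C.d i) R)) fun i => by
      rw [← ModuleCat.ofHom_comp]
      refine congrArg _ (LinearMap.ext fun x => ?_)
      rw [LinearMap.comp_apply, ← act_mul, C.d_comp, act_zero]
      rfl

lemma chainComplex_d (i : ℕ) :
    C.chainComplex.d (i + 1) i = ModuleCat.ofHom (act (C.d i) R) :=
  ChainComplex.of_d (fun i => ModuleCat.of R (Fin (C.rk i) → R))
    (fun i => ModuleCat.ofHom (act (C.d i) R)) i

lemma chainComplex_exactAt_succ {i : ℕ} (hT : C.TorVanish i R) :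
    C.chainComplex.ExactAt (i + 1) := by
  rw [HomologicalComplex.exactAt_iff' _ (i + 2) (i + 1) i (by simp) (by simp),
    ShortComplex.moduleCat_exact_iff]
  intro x hx
  obtain ⟨w, hw⟩ := hT x ((congrArg (fun f => f.hom x) (C.chainComplex_d i)).symm.trans hx)
  exact ⟨w, (congrArg (fun f => f.hom w) (C.chainComplex_d (i + 1))).trans hw⟩

variable {B : Type} [AddCommGroup B] [Module R B]

lemma ofHom_act_comp_mkQ (e : C.Coker 0 ≃ₗ[R] B) :
    ModuleCat.ofHom (act (C.d 0) R) ≫ ModuleCat.ofHom (e.toLinearMap ∘ₗ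
      Submodule.mkQ (LinearMap.range (act (C.d 0) R))) = 0 := by
  rw [← ModuleCat.ofHom_comp]
  refine congrArg ModuleCat.ofHom (LinearMap.ext fun x => ?_)
  refine (congrArg e ((Submodule.Quotient.mk_eq_zero _).2 ⟨x, rfl⟩)).trans (map_zero e)

/-- The projective resolution given by an exact complex of matrices. -/
noncomputable def projectiveResolution (hT : ∀ i, C.TorVanish i R) (e : C.Coker 0 ≃ₗ[R] B) :
    ProjectiveResolution (ModuleCat.of R B) where
  complex := C.chainComplex
  projective i := inferInstanceAs (Projective (ModuleCat.of R (Fin (C.rk i) → R)))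
  π := (ChainComplex.toSingle₀Equiv _ _).symm
    ⟨ModuleCat.ofHom (e.toLinearMap ∘ₗ Submodule.mkQ (LinearMap.range (act (C.d 0) R))), by
      rw [C.chainComplex_d]
      exact C.ofHom_act_comp_mkQ e⟩
  quasiIso := ⟨fun n => by
    cases n
    · rw [ChainComplex.quasiIsoAt₀_iff, ShortComplex.quasiIso_iff_of_zeros']
      · refine (ShortComplex.exact_and_epi_g_iff_of_iso (S₂ := ShortComplex.mk
          (ModuleCat.ofHom (act (C.d 0) R))
          (ModuleCat.ofHom (e.toLinearMap ∘ₗ Submodule.mkQ (LinearMap.range (act (C.d 0) R))))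
          (C.ofHom_act_comp_mkQ e))
          (ShortComplex.isoMk (Iso.refl _) (Iso.refl _) (Iso.refl _) ?_ ?_)).2 ⟨?_, ?_⟩
        · simp
        · simp
        · rw [ShortComplex.moduleCat_exact_iff]
          intro x hx
          exact (Submodule.Quotient.mk_eq_zero _).1 (e.map_eq_zero_iff.1 hx)
        · rw [ModuleCat.epi_iff_surjective]
          exact e.surjective.comp (Submodule.mkQ_surjective _)
      all_goals rfl
    · rw [quasiIsoAt_iff_exactAt']
      · exact C.chainComplex_exactAt_succ (hT _)
      · apply ChainComplex.exactAt_succ_single_obj⟩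

variable {Y : Type} [AddCommGroup Y] [Module R Y]

lemma constr_comp_act {a b : ℕ} (A : Matrix (Fin a) (Fin b) R) (y : Fin a → Y) :
    (Pi.basisFun R (Fin a)).constr R y ∘ₗ act A R =
      (Pi.basisFun R (Fin b)).constr R (act A.transpose Y y) := by
  refine (Pi.basisFun R (Fin b)).ext fun j => ?_
  rw [Module.Basis.constr_basis, LinearMap.comp_apply, Module.Basis.constr_apply_fintype,
    act_apply]
  simp [act_apply, Pi.single_apply]

lemma extVanish_of_subsingleton_extGroup (hT : ∀ i, C.TorVanish i R) (e : C.Coker 0 ≃ₗ[R] B)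
    {i : ℕ} (h : Subsingleton (extGroup R (i + 1) B Y)) : C.ExtVanish i Y := by
  intro y hy
  obtain ⟨ψ, hψ⟩ := ProjectiveResolution.exists_eq_comp (C.projectiveResolution hT e) i h
    (ModuleCat.ofHom ((Pi.basisFun R (Fin (C.rk (i + 1)))).constr R y)) (by
      refine (congrArg (· ≫ _) (C.chainComplex_d (i + 1))).trans ?_
      refine (ModuleCat.ofHom_comp _ _).symm.trans ?_
      rw [constr_comp_act, hy, map_zero]
      rfl)
  obtain ⟨w, hw⟩ := ((Pi.basisFun R (Fin (C.rk i))).constr R).surjective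
    (show (Fin (C.rk i) → R) →ₗ[R] Y from ψ.hom)
  refine ⟨w, ((Pi.basisFun R (Fin (C.rk (i + 1)))).constr R).injective ?_⟩
  rw [← constr_comp_act, hw]
  refine (congrArg ModuleCat.Hom.hom ((congrArg (· ≫ ψ) (C.chainComplex_d i)).symm.trans hψ))

lemma eq_zero_of_subsingleton_extGroup (hT : ∀ i, C.TorVanish i R) (e : C.Coker 0 ≃ₗ[R] B)
    (h : Subsingleton (extGroup R 0 B Y)) (y : Fin (C.rk 0) → Y)
    (hy : act (C.d 0).transpose Y y = 0) : y = 0 := by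
  have := ProjectiveResolution.eq_zero (C.projectiveResolution hT e) h
    (ModuleCat.ofHom ((Pi.basisFun R (Fin (C.rk 0))).constr R y)) (by
      refine (congrArg (· ≫ _) (C.chainComplex_d 0)).trans ?_
      refine (ModuleCat.ofHom_comp _ _).symm.trans ?_
      rw [constr_comp_act, hy, map_zero]
      rfl)
  refine ((Pi.basisFun R (Fin (C.rk 0))).constr R).map_eq_zero_iff.1 ?_
  exact congrArg ModuleCat.Hom.hom this

end MatComplex

section Depth

variable (R) [IsNoetherianRing R] [IsLocalRing R]

/-- The cokernel of the row of generators of the maximal ideal is the residue field. -/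
noncomputable def fieldResCokerEquiv : (fieldRes R).Coker 0 ≃ₗ[R] (R ⧸ maximalIdeal R) :=
  Submodule.Quotient.equiv _ _ (LinearEquiv.funUnique (Fin 1) R R) (by
    change Submodule.map _ (LinearMap.range (act (maxRow R) R)) = _
    rw [← LinearMap.range_comp, ← span_maxGen R, Ideal.span, ← Fintype.range_linearCombination]
    congr 1
    ext j
    simp [act_apply, maxRow, Pi.single_apply])

variable {R}

lemma kres_extVanish_of_subsingleton_extGroup {Y : Type} [AddCommGroup Y] [Module R Y] {i : ℕ}
    (h : Subsingleton (extGroup R i (R ⧸ maximalIdeal R) Y)) : (kres R).ExtVanish i Y := by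
  cases i with
  | zero =>
    rw [kres_extVanish_zero]
    intro y hy
    rw [forall_mem_maximalIdeal_smul_eq_zero_iff] at hy
    have := (fieldRes R).eq_zero_of_subsingleton_extGroup (torVanish_res _)
      (fieldResCokerEquiv R) h (fun _ => y) (funext fun j =>
        (act_maxRow_transpose (fun _ => y) j).trans (hy j))
    exact congrFun this (0 : Fin 1)
  | succ i =>
    exact (fieldRes R).extVanish_of_subsingleton_extGroup (torVanish_res _)
      (fieldResCokerEquiv R) h

lemma IsCMLocal.kres_extVanish (h : IsCMLocal R) {i : ℕ} (hi : (i : WithBot ℕ∞) < ringKrullDim R) :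
    (kres R).ExtVanish i R := by
  refine kres_extVanish_of_subsingleton_extGroup (not_nontrivial_iff_subsingleton.1 fun hn => ?_)
  have h1 : moduleDepth R R ≤ i := sInf_le ⟨i, rfl, hn⟩
  have h2 : ((i : ℕ∞) : WithBot ℕ∞) < moduleDepth R R := h ▸ hi
  exact (WithBot.coe_lt_coe.1 h2).not_ge h1

end Depth

end ExtLink

section DepthDimension

variable {R : Type} [CommRing R] [IsNoetherianRing R]

lemma exists_isSMulRegular {Y : Type} [AddCommGroup Y] [Module R Y] [Module.Finite R Y]
    (I : Ideal R) (h : ∀ y : Y, (∀ a ∈ I, a • y = 0) → y = 0) :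
    ∃ x ∈ I, IsSMulRegular Y x := by
  have hs : Subsingleton ((R ⧸ I) →ₗ[R] Y) := by
    refine subsingleton_of_forall_eq 0 fun f => ?_
    ext
    refine h _ fun a ha => ?_
    change a • f 1 = 0
    rw [← map_smul, Algebra.smul_def, mul_one]
    exact (congrArg f (Ideal.Quotient.eq_zero_iff_mem.2 ha)).trans (map_zero f)
  obtain ⟨x, hx, hreg⟩ := IsSMulRegular.subsingleton_linearMap_iff.1 hs
  rw [Ideal.annihilator_quotient] at hx
  exact ⟨x, hx, hreg⟩

variable [IsLocalRing R]

lemma le_coheight_of_kres_extVanish (r : ℕ) {Y : Type} [AddCommGroup Y] [Module R Y]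
    [Module.Finite R Y] (h : ∀ i < r, (kres R).ExtVanish i Y) (q : PrimeSpectrum R) {y : Y}
    (hy : y ≠ 0) (hq : ∀ a ∈ q.asIdeal, a • y = 0) : (r : ℕ∞) ≤ Order.coheight q := by
  induction r generalizing Y q with
  | zero => simp
  | succ r ih =>
    obtain ⟨x, hx, hreg⟩ := exists_isSMulRegular (maximalIdeal R)
      (kres_extVanish_zero.1 (h 0 r.succ_pos))
    let N : Submodule R Y := Submodule.torsionBySet R Y q.asIdeal
    obtain ⟨z, hzN, hz⟩ : ∃ z ∈ N, z ∉ LinearMap.range (LinearMap.lsmul R Y x) := by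
      by_contra! hcon
      have hN : N ≤ Ideal.span {x} • N := by
        intro z hz
        obtain ⟨u, rfl⟩ := hcon z hz
        refine Submodule.smul_mem_smul (Ideal.mem_span_singleton_self x)
          ((Submodule.mem_torsionBySet_iff _ _).2 fun a => hreg ?_)
        have := (Submodule.mem_torsionBySet_iff _ _).1 hz a
        simp only [LinearMap.lsmul_apply] at this
        change x • a.1 • u = x • 0
        rw [smul_zero, smul_comm, this]
      have h0 := Submodule.eq_bot_of_le_smul_of_le_jacobson_bot (Ideal.span {x}) N
        (IsNoetherian.noetherian N) hN (by
          rw [Ideal.span_singleton_le_iff_mem]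
          exact maximalIdeal_le_jacobson _ hx)
      exact hy ((Submodule.eq_bot_iff _).1 h0 y
        ((Submodule.mem_torsionBySet_iff _ _).2 fun a => hq a a.2))
    obtain ⟨P, hP, hle⟩ := exists_le_isAssociatedPrime_of_isNoetherianRing R
      ((LinearMap.range (LinearMap.lsmul R Y x)).mkQ z) (by simpa using hz)
    obtain ⟨hPp, w, hw⟩ := isAssociatedPrime_iff.1 hP
    have hlt : q < ⟨P, hPp⟩ := by
      refine lt_of_le_of_ne (fun a ha => hle ?_) fun he => ?_
      · rw [Submodule.mem_colon_singleton]
        have := (Submodule.mem_torsionBySet_iff _ _).1 hzN ⟨a, ha⟩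
        change a • z = 0 at this
        rw [← map_smul, this, map_zero]
        exact Submodule.zero_mem _
      · refine hy (hreg ?_)
        change x • y = x • 0
        rw [smul_zero]
        refine hq x ?_
        rw [he]
        refine hle ?_
        rw [Submodule.mem_colon_singleton, ← map_smul, Submodule.mem_bot]
        exact (Submodule.Quotient.mk_eq_zero _).2 ⟨z, rfl⟩
    refine le_trans ?_ (Order.coheight_add_one_le hlt)
    rw [Nat.cast_succ]
    refine add_le_add_left (ih (Y := Y ⧸ LinearMap.range (LinearMap.lsmul R Y x)) (fun i hi => ?_)
      ⟨P, hPp⟩ (y := w) ?_ ?_) 1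
    · exact MatComplex.ExtVanish.right (f := LinearMap.lsmul R Y x) hreg (LinearMap.exact_map_mkQ_range _)
        (Submodule.mkQ_surjective _) (h _ (by omega)) (h _ (by omega))
    · rintro rfl
      exact hPp.ne_top (by rw [hw]; simp)
    · intro a ha
      have : a ∈ P := ha
      rwa [hw, Submodule.mem_colon_singleton, Submodule.mem_bot] at this

lemma exists_not_kres_extVanish {d : ℕ} (hd : ringKrullDim R ≤ d) :
    ∃ i ≤ d, ¬ (kres R).ExtVanish i R := by
  by_contra! h
  obtain ⟨P, hP, -⟩ := exists_le_isAssociatedPrime_of_isNoetherianRing R (1 : R) one_ne_zero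
  obtain ⟨hPp, w, hw⟩ := isAssociatedPrime_iff.1 hP
  have h1 := le_coheight_of_kres_extVanish (d + 1) (fun i hi => h i (by omega)) ⟨P, hPp⟩ (y := w)
    (by rintro rfl; exact hPp.ne_top (by rw [hw]; simp))
    (by
      intro a ha
      have : a ∈ P := ha
      rwa [hw, Submodule.mem_colon_singleton, Submodule.mem_bot] at this)
  have h2 := (WithBot.coe_le_coe.2 h1).trans ((Order.coheight_le_krullDim _).trans hd)
  have h3 : ((d + 1 : ℕ) : WithBot ℕ∞) ≤ (d : ℕ) := h2
  rw [Nat.cast_le] at h3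
  omega

lemma kres_extVanish_succ_of_smul {Z W : Type} [AddCommGroup Z] [Module R Z] [AddCommGroup W]
    [Module R W] {s : R} (hs : s ∈ maximalIdeal R) (g : Z →ₗ[R] W)
    (hf : IsSMulRegular Z s) (hfg : Function.Exact (LinearMap.lsmul R Z s) g)
    (hg : Function.Surjective g) {i : ℕ} (h : (kres R).ExtVanish i W) :
    (kres R).ExtVanish (i + 1) Z := by
  refine kres_eq_zero_of_smul hs fun y hy ⟨w, hw⟩ => ?_
  have hs0 : ∀ z, g (s • z) = 0 := fun z => (hfg _).2 ⟨z, rfl⟩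
  obtain ⟨v, hv⟩ := h (fun j => g (w j)) (by
    rw [act_comp, hw]
    exact funext fun j => hs0 _)
  obtain ⟨v', hv'⟩ : ∃ v' : Fin ((kres R).rk i) → Z, (fun j => g (v' j)) = v :=
    ⟨fun j => (hg (v j)).choose, funext fun j => (hg (v j)).choose_spec⟩
  have hz : ∀ j, g ((w - act ((kres R).d i).transpose Z v') j) = 0 := by
    intro j
    rw [Pi.sub_apply, map_sub, ← congrFun hv j, ← hv', act_comp, sub_self]
  choose u hu using fun j => (hfg _).1 (hz j)
  refine ⟨u, funext fun j => hf ?_⟩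
  have h1 : w - act ((kres R).d i).transpose Z v' = s • u := funext fun j => (hu j).symm
  have h2 := congrArg (act ((kres R).d (i + 1)).transpose Z) h1
  rw [map_sub, hw, ← act_mul, (kres R).d_comp_transpose, act_zero, map_smul] at h2
  simpa using (congrFun h2 j).symm

lemma kres_localization_extVanish (p : PrimeSpectrum R) {s : ℕ} (hs : Order.coheight p ≤ s)
    (i : ℕ) {Y : Type} [AddCommGroup Y] [Module R Y] [Module.Finite R Y]
    (h : ∀ j < i + s + 1, (kres R).ExtVanish j Y) :
    (kres (Localization.AtPrime p.asIdeal)).ExtVanish i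
      (LocalizedModule p.asIdeal.primeCompl Y) := by
  obtain ⟨x, hx, hreg⟩ : ∃ x ∈ p.asIdeal, IsSMulRegular Y x := by
    refine exists_isSMulRegular _ fun y hy => ?_
    by_contra hy0
    have := (le_coheight_of_kres_extVanish _ h p hy0 hy).trans hs
    rw [Nat.cast_le] at this
    omega
  have hx' : algebraMap R (Localization.AtPrime p.asIdeal) x ∈
      maximalIdeal (Localization.AtPrime p.asIdeal) :=
    (IsLocalization.AtPrime.to_map_mem_maximal_iff _ p.asIdeal x).2 hx
  have hreg' : IsSMulRegular (LocalizedModule p.asIdeal.primeCompl Y)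
      (algebraMap R (Localization.AtPrime p.asIdeal) x) :=
    hreg.of_isLocalizedModule _ p.asIdeal.primeCompl
      (LocalizedModule.mkLinearMap p.asIdeal.primeCompl Y)
  cases i with
  | zero =>
    rw [kres_extVanish_zero]
    intro y hy
    refine hreg' ?_
    change _ • y = _ • 0
    rw [smul_zero, hy _ hx']
  | succ i =>
    let g := (LinearMap.range (LinearMap.lsmul R Y x)).mkQ
    have ih := kres_localization_extVanish p hs i
      (Y := Y ⧸ LinearMap.range (LinearMap.lsmul R Y x)) fun j hj =>
        MatComplex.ExtVanish.right (f := LinearMap.lsmul R Y x) hreg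
          (LinearMap.exact_map_mkQ_range _) (Submodule.mkQ_surjective _)
          (h _ (by omega)) (h _ (by omega))
    refine kres_extVanish_succ_of_smul hx' (LocalizedModule.map p.asIdeal.primeCompl g) hreg' ?_
      (LocalizedModule.map_surjective _ _ (Submodule.mkQ_surjective _)) ih
    have hex := LocalizedModule.map_exact p.asIdeal.primeCompl (LinearMap.lsmul R Y x) g
      (LinearMap.exact_map_mkQ_range _)
    have hl : IsLocalizedModule.map p.asIdeal.primeCompl
        (LocalizedModule.mkLinearMap p.asIdeal.primeCompl Y)
        (LocalizedModule.mkLinearMap p.asIdeal.primeCompl Y) (LinearMap.lsmul R Y x) =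
        LinearMap.lsmul R _ x := by
      refine IsLocalizedModule.linearMap_ext p.asIdeal.primeCompl
        (LocalizedModule.mkLinearMap p.asIdeal.primeCompl Y)
        (LocalizedModule.mkLinearMap p.asIdeal.primeCompl Y) (LinearMap.ext fun y => ?_)
      rw [LinearMap.comp_apply, IsLocalizedModule.map_apply]
      exact map_smul _ _ _
    rw [hl] at hex
    intro y
    refine (hex y).trans ?_
    simp [Set.mem_range]

end DepthDimension

section Localization

variable {R : Type} [CommRing R] (S : Submonoid R)

lemma IsLocalizedModule.map_act {ι κ : Type} [Finite ι] [Fintype κ] (A : Matrix ι κ R)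
    {Y Z : Type} [AddCommGroup Y] [Module R Y] [AddCommGroup Z] [Module R Z] (f : Y →ₗ[R] Z)
    [IsLocalizedModule S f] :
    IsLocalizedModule.map S (LinearMap.pi fun j : κ => f ∘ₗ LinearMap.proj j)
      (LinearMap.pi fun i : ι => f ∘ₗ LinearMap.proj i) (act A Y) = act A Z := by
  refine IsLocalizedModule.linearMap_ext S (LinearMap.pi fun j : κ => f ∘ₗ LinearMap.proj j)
    (LinearMap.pi fun i : ι => f ∘ₗ LinearMap.proj i) (LinearMap.ext fun y => ?_)
  rw [LinearMap.comp_apply, IsLocalizedModule.map_apply]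
  exact (act_comp A f y).symm

lemma ExactOn.localized {ι κ l : Type} [Finite ι] [Fintype κ] [Fintype l] {A : Matrix ι κ R}
    {B : Matrix κ l R} {Y Z : Type} [AddCommGroup Y] [Module R Y] [AddCommGroup Z] [Module R Z]
    (f : Y →ₗ[R] Z) [IsLocalizedModule S f] (hAB : A * B = 0) (h : ExactOn A B Y) :
    ExactOn A B Z := by
  have hex : Function.Exact (act B Y) (act A Y) := fun y =>
    ⟨fun hy => h y hy, by rintro ⟨w, rfl⟩; rw [← act_mul, hAB, act_zero]⟩
  have := IsLocalizedModule.map_exact S (LinearMap.pi fun j : l => f ∘ₗ LinearMap.proj j)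
    (LinearMap.pi fun j : κ => f ∘ₗ LinearMap.proj j)
    (LinearMap.pi fun i : ι => f ∘ₗ LinearMap.proj i) _ _ hex
  rw [IsLocalizedModule.map_act, IsLocalizedModule.map_act] at this
  exact fun y hy => (this y).1 hy

namespace MatComplex

variable (C : MatComplex R) (A : Type) [CommRing A] [Algebra R A]

lemma TorVanish.localized {C : MatComplex R} {Y Z : Type} [AddCommGroup Y] [Module R Y]
    [AddCommGroup Z] [Module R Z] [Module A Z] [IsScalarTower R A Z] (f : Y →ₗ[R] Z)
    [IsLocalizedModule S f] {i : ℕ} (h : C.TorVanish i Y) :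
    (C.map (algebraMap R A)).TorVanish i Z := by
  intro y hy
  obtain ⟨w, hw⟩ := ExactOn.localized S f (C.d_comp i) h y
    ((act_map (S := A) (C.d i) y).symm.trans hy)
  exact ⟨w, (act_map (S := A) (C.d (i + 1)) w).trans hw⟩

lemma ExtVanish.localized {C : MatComplex R} {Y Z : Type} [AddCommGroup Y] [Module R Y]
    [AddCommGroup Z] [Module R Z] [Module A Z] [IsScalarTower R A Z] (f : Y →ₗ[R] Z)
    [IsLocalizedModule S f] {i : ℕ} (h : C.ExtVanish i Y) :
    (C.map (algebraMap R A)).ExtVanish i Z := by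
  intro y hy
  obtain ⟨w, hw⟩ := ExactOn.localized S f (C.d_comp_transpose i) h y
    ((act_map (S := A) (C.d (i + 1)).transpose y).symm.trans hy)
  exact ⟨w, (act_map (S := A) (C.d i).transpose w).trans hw⟩

variable [IsLocalization S A]

lemma nonempty_coker_map_equiv {M Z : Type} [AddCommGroup M] [Module R M] [AddCommGroup Z]
    [Module R Z] [Module A Z] [IsScalarTower R A Z] (f : M →ₗ[R] Z) [IsLocalizedModule S f]
    {i : ℕ} (e : C.Coker i ≃ₗ[R] M) :
    Nonempty ((C.map (algebraMap R A)).Coker i ≃ₗ[A] Z) := by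
  let g : (Fin (C.rk i) → R) →ₗ[R] M := e.toLinearMap ∘ₗ Submodule.mkQ _
  have hg : Function.Surjective g := e.surjective.comp (Submodule.mkQ_surjective _)
  have hex : Function.Exact (act (C.d i) R) g := fun x =>
    (e.map_eq_zero_iff).trans (Submodule.Quotient.mk_eq_zero _)
  let a := Algebra.linearMap R A
  have hex' := IsLocalizedModule.map_exact S
    (LinearMap.pi fun j : Fin (C.rk (i + 1)) => a ∘ₗ LinearMap.proj j)
    (LinearMap.pi fun j : Fin (C.rk i) => a ∘ₗ LinearMap.proj j) f _ _ hex
  rw [IsLocalizedModule.map_act] at hex'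
  let g' : (Fin (C.rk i) → A) →ₗ[A] Z := IsLocalizedModule.mapExtendScalars S
    (LinearMap.pi fun j : Fin (C.rk i) => a ∘ₗ LinearMap.proj j) f A g
  have hg' : Function.Surjective g' := IsLocalizedModule.map_surjective S
    (LinearMap.pi fun j : Fin (C.rk i) => a ∘ₗ LinearMap.proj j) f g hg
  refine ⟨(Submodule.quotEquivOfEq _ _ ?_).trans (g'.quotKerEquivOfSurjective hg')⟩
  ext x
  refine Iff.trans ?_ (hex' x).symm
  refine exists_congr fun w => ?_
  rw [show act ((C.map (algebraMap R A)).d i) A w = act (C.d i) A w from act_map (C.d i) w]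
  exact Iff.rfl

lemma exists_mem_splitIdeal_of_one_mem_map (h : 1 ∈ (C.map (algebraMap R A)).splitIdeal 0) :
    ∃ r ∈ S, r ∈ C.splitIdeal 0 := by
  obtain ⟨σ, hσ⟩ : ∃ σ : Matrix (Fin (C.rk 1)) (Fin (C.rk 0)) A,
      (1 : A) • (C.d 0).map (algebraMap R A) =
        (C.d 0).map (algebraMap R A) * σ * (C.d 0).map (algebraMap R A) := h
  rw [one_smul] at hσ
  let a := Algebra.linearMap R A
  let F : ∀ m n : ℕ, (Fin m → Fin n → R) →ₗ[R] (Fin m → Fin n → A) := fun m n =>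
    LinearMap.pi fun i => (LinearMap.pi fun j => a ∘ₗ LinearMap.proj j) ∘ₗ LinearMap.proj i
  have hF : ∀ m n, IsLocalizedModule S (F m n) := fun m n => inferInstance
  obtain ⟨⟨τ, b⟩, hτ⟩ := IsLocalizedModule.surj S (F (C.rk 1) (C.rk 0)) σ
  let τ' : Matrix (Fin (C.rk 1)) (Fin (C.rk 0)) R := τ
  have hτ' : τ'.map (algebraMap R A) = (b : R) • σ := hτ.symm
  have h0 : F (C.rk 0) (C.rk 1) ((b : R) • C.d 0 - C.d 0 * τ' * C.d 0) = 0 := by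
    change ((b : R) • C.d 0 - C.d 0 * τ' * C.d 0).map (algebraMap R A) = 0
    rw [Matrix.map_sub _ (by simp), Matrix.map_mul, Matrix.map_mul, hτ', Matrix.mul_smul,
      Matrix.smul_mul, ← hσ, sub_eq_zero]
    ext i j
    simp [Algebra.smul_def]
  obtain ⟨c, hc⟩ := (IsLocalizedModule.eq_zero_iff S _).1 h0
  refine ⟨c * b, mul_mem c.2 b.2, (c : R) • τ', ?_⟩
  rw [Matrix.mul_smul, Matrix.smul_mul, mul_smul, ← sub_eq_zero, ← smul_sub]
  exact hc

end MatComplex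

end Localization

section Assembly

variable {R : Type} [CommRing R]

lemma MatComplex.map_splitIdeal_le (C : MatComplex R) (A : Type) [CommRing A] [Algebra R A] :
    (C.splitIdeal 0).map (algebraMap R A) ≤ (C.map (algebraMap R A)).splitIdeal 0 := by
  rw [Ideal.map_le_iff_le_comap]
  rintro r ⟨σ, hσ⟩
  refine ⟨σ.map (algebraMap R A), ?_⟩
  change algebraMap R A r • (C.d 0).map (algebraMap R A) =
    (C.d 0).map (algebraMap R A) * σ.map (algebraMap R A) * (C.d 0).map (algebraMap R A)
  rw [← Matrix.map_mul, ← Matrix.map_mul, ← hσ]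
  ext i j
  simp

lemma exists_coheight_add_le [IsLocalRing R] {d n : ℕ} (hd : ringKrullDim R ≤ d) (p : PrimeSpectrum R)
    (hp : (n : WithBot ℕ∞) < ringKrullDim (Localization.AtPrime p.asIdeal)) :
    ∃ s : ℕ, Order.coheight p ≤ s ∧ n + s + 1 ≤ d := by
  rw [IsLocalization.AtPrime.ringKrullDim_eq_height p.asIdeal,
    PrimeSpectrum.height_eq_orderHeight] at hp
  have h1 : Order.height p + Order.coheight p ≤ (d : ℕ∞) := by
    rw [ringKrullDim, Order.krullDim_eq_iSup_height_add_coheight_of_nonempty] at hd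
    exact (le_iSup (fun a : PrimeSpectrum R => Order.height a + Order.coheight a) p).trans
      (WithBot.coe_le_coe.1 hd)
  have h2 : (n : ℕ∞) < Order.height p := WithBot.coe_lt_coe.1 hp
  obtain ⟨s, hs⟩ := ENat.ne_top_iff_exists.1
    (ne_top_of_le_ne_top (ENat.natCast_ne_top d) (le_add_self.trans h1))
  refine ⟨s, hs.ge, ?_⟩
  have h3 : ((n + 1 + s : ℕ) : ℕ∞) ≤ d := by
    rw [Nat.cast_add, Nat.cast_succ, hs]
    exact (add_le_add_left (Order.add_one_le_of_lt h2) _).trans h1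
  rw [Nat.cast_le] at h3
  omega

lemma ringKrullDim_localization_le {d : ℕ} (hd : ringKrullDim R ≤ d) (p : PrimeSpectrum R) :
    ringKrullDim (Localization.AtPrime p.asIdeal) ≤ d := by
  rw [IsLocalization.AtPrime.ringKrullDim_eq_height p.asIdeal,
    PrimeSpectrum.height_eq_orderHeight]
  exact (Order.height_le_krullDim p).trans hd

variable [IsNoetherianRing R]

lemma MatComplex.exists_maximalIdeal_pow_le (C : MatComplex R) (p : Ideal R) [p.IsPrime]
    (hp : p ∈ (C.splitIdeal 0).minimalPrimes) :
    ∃ N, maximalIdeal (Localization.AtPrime p) ^ N ≤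
      (C.map (algebraMap R (Localization.AtPrime p))).splitIdeal 0 := by
  have h := IsLocalization.AtPrime.radical_map_of_mem_minimalPrimes (Localization.AtPrime p) p
    _ hp
  rw [Localization.AtPrime.map_eq_maximalIdeal] at h
  obtain ⟨N, hN⟩ := Ideal.exists_pow_le_of_le_radical_of_fg h.ge (IsNoetherian.noetherian _)
  exact ⟨N, hN.trans (C.map_splitIdeal_le _)⟩

variable [IsLocalRing R]

lemma IsAuslanderTranspose.exists_matrix {M T : Type} [AddCommGroup M] [Module R M]
    [AddCommGroup T] [Module R T] (h : IsAuslanderTranspose R M T) :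
    ∃ (a b : ℕ) (A : Matrix (Fin a) (Fin b) R),
      Nonempty ((res A).Coker 0 ≃ₗ[R] M) ∧ Nonempty ((res A.transpose).Coker 0 ≃ₗ[R] T) := by
  obtain ⟨m, n, f, -, -, ⟨e⟩, ⟨e'⟩⟩ := h
  have hf : act (LinearMap.toMatrix' f) R = f := LinearMap.ext fun x => by
    rw [act_self, LinearMap.toMatrix'_mulVec]
  refine ⟨m, n, LinearMap.toMatrix' f,
    ⟨(Submodule.quotEquivOfEq _ _ (congrArg LinearMap.range hf)).trans e⟩,
    ⟨(Submodule.Quotient.equiv _ _ ((Pi.basisFun R (Fin n)).constr R) ?_).trans e'⟩⟩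
  have hc : ((Pi.basisFun R (Fin n)).constr R).toLinearMap ∘ₗ
      act (LinearMap.toMatrix' f).transpose R =
      f.dualMap ∘ₗ ((Pi.basisFun R (Fin m)).constr R).toLinearMap := LinearMap.ext fun y => by
    have := MatComplex.constr_comp_act (LinearMap.toMatrix' f) y
    rw [hf] at this
    exact this.symm
  change Submodule.map ((Pi.basisFun R (Fin n)).constr R).toLinearMap
    (LinearMap.range (act (LinearMap.toMatrix' f).transpose R)) = _
  rw [← LinearMap.range_comp, hc, LinearMap.range_comp, LinearEquiv.range, Submodule.map_top]

/-- The localized module `LocalizedModule` of the ring itself is the localized ring. -/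
noncomputable def localizedModuleSelfEquiv (p : Ideal R) [p.IsPrime] :
    LocalizedModule p.primeCompl R ≃ₗ[Localization.AtPrime p] Localization.AtPrime p :=
  (IsLocalizedModule.linearEquiv p.primeCompl (LocalizedModule.mkLinearMap p.primeCompl R)
    (Algebra.linearMap R (Localization.AtPrime p))).extendScalarsOfIsLocalization p.primeCompl
    (Localization.AtPrime p)

lemma exists_localization_depth {d n : ℕ} (hd : ringKrullDim R = d) (hCM : IsCMLocal R)
    (p : PrimeSpectrum R) :
    ∃ h ≤ d, (∀ j < h, (kres (Localization.AtPrime p.asIdeal)).ExtVanish j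
        (Localization.AtPrime p.asIdeal)) ∧
      ¬ (kres (Localization.AtPrime p.asIdeal)).ExtVanish h (Localization.AtPrime p.asIdeal) ∧
      ((n : WithBot ℕ∞) < ringKrullDim (Localization.AtPrime p.asIdeal) → n < h) := by
  classical
  have hex := exists_not_kres_extVanish (ringKrullDim_localization_le hd.le p)
  have hex' : ∃ i, ¬ (kres (Localization.AtPrime p.asIdeal)).ExtVanish i
      (Localization.AtPrime p.asIdeal) := hex.imp fun _ => And.right
  refine ⟨Nat.find hex', ?_, fun j hj => not_not.1 (Nat.find_min hex' hj), Nat.find_spec hex',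
    fun hn => ?_⟩
  · obtain ⟨i, hi, hi'⟩ := hex
    exact (Nat.find_min' hex' hi').trans hi
  · obtain ⟨s, hs, hsd⟩ := exists_coheight_add_le hd.le p hn
    rw [Nat.lt_find_iff]
    refine fun i hi => not_not.2 ?_
    refine ExactOn.congr (kres_localization_extVanish p hs i fun j hj => hCM.kres_extVanish ?_)
      (localizedModuleSelfEquiv p.asIdeal)
    rw [hd, Nat.cast_lt]
    omega

end Assembly

section Conclusion

variable {R : Type} [CommRing R] [IsNoetherianRing R] [IsLocalRing R]

lemma MatComplex.one_mem_splitIdeal_of_hasPdLE {C : MatComplex R} (hC : ∀ i, C.TorVanish i R)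
    {N : ℕ} (hI : maximalIdeal R ^ N ≤ C.splitIdeal 0) {h : ℕ}
    (hh : ∀ j < h, (kres R).ExtVanish j R) (hh' : ¬ (kres R).ExtVanish h R)
    (hX : ∀ j < h, C.ExtVanish j R) {t k : ℕ} {M : Type} [AddCommGroup M] [Module R M]
    (e : C.Coker t ≃ₗ[R] M) (hM : hasPdLE R k M) : (1 : R) ∈ C.splitIdeal 0 := by
  have := hM.hasProjectiveDimensionLT
  have e' : ModuleCat.of R M ≅ ModuleCat.of R (C.Coker t) := e.symm.toModuleIso
  have := C.hasProjectiveDimensionLT_coker hC (hasProjectiveDimensionLT_of_iso e' (k + 1))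
  exact C.one_mem_of_split hC hI hh hh' hX (C.one_mem_splitIdeal_of_projective (i := t + k))

lemma MatComplex.one_mem_splitIdeal {C : MatComplex R} (hC : ∀ i, C.TorVanish i R) {d n t : ℕ}
    (hd : ringKrullDim R = d) (hCM : IsCMLocal R) (hn : 1 ≤ n) (ht : t ≤ d + 2)
    {M : Type} [AddCommGroup M] [Module R M] (e : C.Coker t ≃ₗ[R] M)
    (hMp : ∀ p : PrimeSpectrum R,
      ringKrullDim (Localization.AtPrime p.asIdeal) ≤ (n : WithBot ℕ∞) →
      ∃ k : ℕ, hasPdLE (Localization.AtPrime p.asIdeal) k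
        (LocalizedModule p.asIdeal.primeCompl M))
    (hX : ∀ j ≤ 2 * d, C.ExtVanish j R)
    (hM : ∀ h, n < h → h ≤ d → C.ExtVanish (h + t - 2) M) : (1 : R) ∈ C.splitIdeal 0 := by
  rw [← Ideal.eq_top_iff_one]
  by_contra hI
  obtain ⟨q, hq⟩ := Ideal.nonempty_minimalPrimes hI
  obtain ⟨p, rfl⟩ : ∃ p : PrimeSpectrum R, p.asIdeal = q := ⟨⟨q, hq.1.1⟩, rfl⟩
  obtain ⟨N, hN⟩ := C.exists_maximalIdeal_pow_le p.asIdeal hq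
  obtain ⟨h, hhd, hh, hh', hhn⟩ := exists_localization_depth (n := n) hd hCM p
  have hC' := fun i => (hC i).localized p.asIdeal.primeCompl (Localization.AtPrime p.asIdeal)
    (Algebra.linearMap R (Localization.AtPrime p.asIdeal))
  have hX' := fun j hj => (hX j hj).localized p.asIdeal.primeCompl
    (Localization.AtPrime p.asIdeal) (Algebra.linearMap R (Localization.AtPrime p.asIdeal))
  obtain ⟨e'⟩ := C.nonempty_coker_map_equiv p.asIdeal.primeCompl
    (Localization.AtPrime p.asIdeal) (LocalizedModule.mkLinearMap p.asIdeal.primeCompl M) e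
  obtain ⟨r, hr, hr'⟩ := C.exists_mem_splitIdeal_of_one_mem_map p.asIdeal.primeCompl
    (Localization.AtPrime p.asIdeal) (by
      obtain hdim | hdim :=
        le_or_gt (ringKrullDim (Localization.AtPrime p.asIdeal)) (n : WithBot ℕ∞)
      · obtain ⟨k, hk⟩ := hMp p hdim
        exact one_mem_splitIdeal_of_hasPdLE hC' hN hh hh' (fun j hj => hX' j (by omega)) e' hk
      · have hnh := hhn hdim
        exact one_mem_of_extVanish_coker hC' hN hh hh' (by omega) hhd ht hX'
          (ExactOn.congr ((hM h hnh hhd).localized p.asIdeal.primeCompl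
            (Localization.AtPrime p.asIdeal)
            (LocalizedModule.mkLinearMap p.asIdeal.primeCompl M)) e'.symm))
  exact hr (hq.1.2 hr')

end Conclusion

/-- Freeness from membership in `G_{2d−t+1, t}` together with self-Ext vanishing and local
finiteness of projective dimension in codimension `n`. -/
theorem free_of_G_class_and_ext_self_vanishing (R : Type) [CommRing R] [IsNoetherianRing R]
    [IsLocalRing R] (d n t : ℕ) (hd : ringKrullDim R = d) (hd2 : 2 ≤ d)
    (hn1 : 1 ≤ n) (hn2 : n ≤ d - 1) (ht : t ≤ d + 2) (hCM : IsCMLocal R)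
    (M T : Type) [AddCommGroup M] [Module R M] [Module.Finite R M]
    [AddCommGroup T] [Module R T]
    (hT : IsAuslanderTranspose R M T)
    (hMp : ∀ p : PrimeSpectrum R, ringKrullDim (Localization.AtPrime p.asIdeal) ≤ (n : WithBot ℕ∞) →
      ∃ k : ℕ, hasPdLE (Localization.AtPrime p.asIdeal) k (LocalizedModule p.asIdeal.primeCompl M))
    (hself : ∀ j : ℕ, n ≤ j → j ≤ d - 1 → Subsingleton (extGroup R j M M))
    (h1 : ∀ i : ℕ, 1 ≤ i → i ≤ 2 * d - t + 1 → Subsingleton (extGroup R i M R))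
    (h2 : ∀ i : ℕ, 1 ≤ i → i ≤ t → Subsingleton (extGroup R i T R)) :
    Module.Free R M := by
  obtain ⟨a, b, A, ⟨e⟩, ⟨e'⟩⟩ := hT.exists_matrix
  obtain ⟨C, hC, hlt, hge, hcoker⟩ := (res A).exists_glue t (torVanish_res A)
    (MatComplex.dualExact t (res A.transpose) (torVanish_res A.transpose) fun i hi =>
      MatComplex.extVanish_of_subsingleton_extGroup _ (torVanish_res A.transpose) e'
        (h2 (i + 1) (by omega) (by omega)))
  obtain ⟨e₀⟩ := hcoker 0
  rw [zero_add] at e₀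
  have h0 : (1 : R) ∈ C.splitIdeal 0 := by
    refine MatComplex.one_mem_splitIdeal hC hd hCM hn1 ht (e₀.trans e) hMp (fun j hj => ?_)
      fun h hnh hhd => ?_
    · obtain hjt | hjt := lt_or_ge j t
      · exact hlt j hjt
      · have := hge (j - t) R (MatComplex.extVanish_of_subsingleton_extGroup _ (torVanish_res A) e
          (h1 (j - t + 1) (by omega) (by omega)))
        rwa [Nat.sub_add_cancel hjt] at this
    · have hs := hself (h - 1) (by omega) (by omega)
      rw [show h - 1 = h - 2 + 1 by omega] at hs
      have := hge (h - 2) M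
        (MatComplex.extVanish_of_subsingleton_extGroup _ (torVanish_res A) e hs)
      rwa [show h - 2 + t = h + t - 2 by omega] at this
  have hproj : Module.Projective R (C.Coker t) :=
    MatComplex.projective_coker_of_one_mem_splitIdeal
      (MatComplex.mem_splitIdeal_of_le (Nat.zero_le t) h0 fun j _ => hC j)
  have : Module.Projective R M := Module.Projective.of_equiv (e₀.trans e)
  exact Module.free_of_flat_of_isLocalRing
end

section
/- Let R be a Noetherian Cohen–Macaulay ring and M a finitely generated R-module with Ext^i_R(M, M ⊕ R) = 0 for all i > 0. If M_p has finite projective dimension over R_p for every prime p of height at most 1, then M is projective. -/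
open CategoryTheory TensorProduct IsLocalRing

section Bridge

variable {R : Type} [CommRing R]

open CategoryTheory.Abelian

lemma ProjectiveResolution.exists_comp_eq_of_isZero_homology {X : ModuleCat.{0} R}
    (P : ProjectiveResolution X) (Y : ModuleCat.{0} R) (p : ℕ)
    (h : Limits.IsZero ((P.complex.linearYonedaObj R Y).homology (p + 1)))
    (f : P.complex.X (p + 1) ⟶ Y) (hf : P.complex.d (p + 2) (p + 1) ≫ f = 0) :
    ∃ g : P.complex.X p ⟶ Y, P.complex.d (p + 1) p ≫ g = f := by
  rw [← HomologicalComplex.exactAt_iff_isZero_homology,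
    HomologicalComplex.exactAt_iff' _ p (p + 1) (p + 2) (by simp) (by simp),
    ShortComplex.moduleCat_exact_iff] at h
  obtain ⟨g, hg⟩ := h f hf
  exact ⟨g, hg⟩

lemma ProjectiveResolution.eq_zero_of_isZero_homology_zero {X : ModuleCat.{0} R}
    (P : ProjectiveResolution X) (Y : ModuleCat.{0} R)
    (h : Limits.IsZero ((P.complex.linearYonedaObj R Y).homology 0))
    (f : P.complex.X 0 ⟶ Y) (hf : P.complex.d 1 0 ≫ f = 0) : f = 0 := by
  rw [← HomologicalComplex.exactAt_iff_isZero_homology,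
    HomologicalComplex.exactAt_iff' _ 0 0 1 (by simp) (by simp),
    ShortComplex.moduleCat_exact_iff] at h
  obtain ⟨g, hg⟩ := h f hf
  have h0 : (P.complex.linearYonedaObj R Y).d 0 0 = 0 :=
    HomologicalComplex.shape _ _ _ (by simp)
  rw [← hg]
  change ((P.complex.linearYonedaObj R Y).d 0 0) g = 0
  rw [h0]; rfl

lemma subsingleton_abelianExt_of_subsingleton_extGroup (M N : Type) [AddCommGroup M] [Module R M]
    [AddCommGroup N] [Module R N] (n : ℕ) [h : Subsingleton (extGroup R n M N)] :
    Subsingleton (Abelian.Ext (ModuleCat.of R M) (ModuleCat.of R N) n) := by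
  obtain ⟨P⟩ := (HasProjectiveResolutions.out (C := ModuleCat.{0} R) (Z := ModuleCat.of R M)).out
  have h' : Limits.IsZero ((P.complex.linearYonedaObj R (ModuleCat.of R N)).homology n) :=
    Limits.IsZero.of_iso (ModuleCat.isZero_of_subsingleton _) (P.isoExt n (ModuleCat.of R N)).symm
  refine subsingleton_of_forall_eq 0 fun α ↦ ?_
  obtain ⟨f, hf, rfl⟩ := P.extMk_surjective α (n + 1) rfl
  cases n with
  | zero =>
    obtain rfl := ProjectiveResolution.eq_zero_of_isZero_homology_zero P _ h' f hf
    simp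
  | succ p =>
    rw [P.extMk_eq_zero_iff f (p + 2) rfl hf p rfl]
    exact ProjectiveResolution.exists_comp_eq_of_isZero_homology P _ p h' f hf

end Bridge

section ExtModules

open CategoryTheory.Abelian

variable {R : Type} [CommRing R] {K F M N : Type} [AddCommGroup K] [Module R K]
  [AddCommGroup F] [Module R F] [AddCommGroup M] [Module R M] [AddCommGroup N] [Module R N]

/-- `Ext^i_R(M, N) = 0`. -/
abbrev ExtZero (R : Type) [CommRing R] (M N : Type) [AddCommGroup M] [Module R M]
    [AddCommGroup N] [Module R N] (i : ℕ) : Prop :=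
  Subsingleton (Abelian.Ext (ModuleCat.of R M) (ModuleCat.of R N) i)

/-- `Ext^i_R(M, N) = 0` for all `i > 0`. -/
def ExtVanishes (R : Type) [CommRing R] (M N : Type) [AddCommGroup M] [Module R M]
    [AddCommGroup N] [Module R N] : Prop :=
  ∀ i : ℕ, ExtZero R M N (i + 1)

/-- The short complex in `ModuleCat` attached to an exact pair of linear maps. -/
abbrev linearShortComplex (f : K →ₗ[R] F) (g : F →ₗ[R] M) (h : Function.Exact f g) :
    ShortComplex (ModuleCat.{0} R) :=
  ShortComplex.mk (ModuleCat.ofHom f) (ModuleCat.ofHom g)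
    (by ext x; exact h.apply_apply_eq_zero x)

lemma linearShortComplex_shortExact {f : K →ₗ[R] F} {g : F →ₗ[R] M}
    (hf : Function.Injective f) (h : Function.Exact f g) (hg : Function.Surjective g) :
    (linearShortComplex f g h).ShortExact where
  exact := (ShortComplex.ShortExact.moduleCat_exact_iff_function_exact _).mpr h
  mono_f := (ModuleCat.mono_iff_injective _).mpr hf
  epi_g := (ModuleCat.epi_iff_surjective _).mpr hg

lemma ExtZero.eq_zero {i : ℕ} (h : ExtZero R M N i)
    (x : Abelian.Ext (ModuleCat.of R M) (ModuleCat.of R N) i) : x = 0 :=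
  Subsingleton.elim _ _

section Contravariant

variable {f : K →ₗ[R] F} {g : F →ₗ[R] M} (hf : Function.Injective f) (hfg : Function.Exact f g)
  (hg : Function.Surjective g)

include hf hfg hg

lemma ExtZero.exists_extension (h : ExtZero R M N 1) (u : K →ₗ[R] N) :
    ∃ v : F →ₗ[R] N, v ∘ₗ f = u := by
  have hS := linearShortComplex_shortExact hf hfg hg
  obtain ⟨x, hx⟩ := Ext.contravariant_sequence_exact₁ hS (ModuleCat.of R N)
    (Ext.mk₀ (ModuleCat.ofHom u)) (n₁ := 1) rfl (h.eq_zero _)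
  obtain ⟨v, rfl⟩ := Ext.addEquiv₀.symm.surjective x
  refine ⟨v.hom, ?_⟩
  have : Ext.mk₀ (ModuleCat.ofHom f ≫ v) = Ext.mk₀ (ModuleCat.ofHom u) := by
    rw [← hx]; exact (Ext.mk₀_comp_mk₀ _ _).symm
  have := Ext.addEquiv₀.symm.injective this
  exact congrArg ModuleCat.Hom.hom this

lemma extZero_one_of_exists_extension [Module.Projective R F]
    (h : ∀ u : K →ₗ[R] N, ∃ v : F →ₗ[R] N, v ∘ₗ f = u) : ExtZero R M N 1 := by
  have hS := linearShortComplex_shortExact hf hfg hg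
  refine subsingleton_of_forall_eq 0 fun x ↦ ?_
  obtain ⟨y, rfl⟩ := Ext.contravariant_sequence_exact₃ hS (ModuleCat.of R N) x
    (Ext.eq_zero_of_projective (n := 0) _) (n₀ := 0) rfl
  obtain ⟨u, rfl⟩ := Ext.addEquiv₀.symm.surjective y
  obtain ⟨v, hv⟩ := h u.hom
  have : u = ModuleCat.ofHom f ≫ ModuleCat.ofHom v := by
    ext1; exact hv.symm
  subst this
  change hS.extClass.comp (Ext.mk₀ _) rfl = 0
  rw [← Ext.mk₀_comp_mk₀]
  exact hS.extClass_comp_assoc _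

lemma extZero_succ_succ_iff [Module.Projective R F] (i : ℕ) :
    ExtZero R M N (i + 2) ↔ ExtZero R K N (i + 1) := by
  have hS := linearShortComplex_shortExact hf hfg hg
  constructor
  · intro h
    refine subsingleton_of_forall_eq 0 fun x ↦ ?_
    obtain ⟨y, rfl⟩ := Ext.contravariant_sequence_exact₁ hS (ModuleCat.of R N) x
      (n₁ := i + 2) (by omega) (h.eq_zero _)
    rw [Ext.eq_zero_of_projective (n := i) y, Ext.comp_zero]
  · intro h
    refine subsingleton_of_forall_eq 0 fun x ↦ ?_
    obtain ⟨y, rfl⟩ := Ext.contravariant_sequence_exact₃ hS (ModuleCat.of R N) x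
      (Ext.eq_zero_of_projective (n := i + 1) _) (n₀ := i + 1) (by omega)
    rw [h.eq_zero y, Ext.comp_zero]

lemma ExtVanishes.syzygy [Module.Projective R F] (h : ExtVanishes R M N) : ExtVanishes R K N :=
  fun i ↦ (extZero_succ_succ_iff hf hfg hg i).mp (h (i + 1))

end Contravariant

section Covariant

variable {A B C : Type} [AddCommGroup A] [Module R A] [AddCommGroup B] [Module R B]
  [AddCommGroup C] [Module R C]
  {f : A →ₗ[R] B} {g : B →ₗ[R] C} (hf : Function.Injective f) (hfg : Function.Exact f g)
  (hg : Function.Surjective g)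

include hf hfg hg

lemma ExtZero.exists_lift (h : ExtZero R M A 1) (u : M →ₗ[R] C) :
    ∃ v : M →ₗ[R] B, g ∘ₗ v = u := by
  have hS := linearShortComplex_shortExact hf hfg hg
  obtain ⟨x, hx⟩ := Ext.covariant_sequence_exact₃ (ModuleCat.of R M) hS
    (Ext.mk₀ (ModuleCat.ofHom u)) (n₁ := 1) rfl (h.eq_zero _)
  obtain ⟨v, rfl⟩ := Ext.addEquiv₀.symm.surjective x
  refine ⟨v.hom, ?_⟩
  have : Ext.mk₀ (v ≫ ModuleCat.ofHom g) = Ext.mk₀ (ModuleCat.ofHom u) := by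
    rw [← hx]; exact (Ext.mk₀_comp_mk₀ _ _).symm
  exact congrArg ModuleCat.Hom.hom (Ext.addEquiv₀.symm.injective this)

lemma extZero_one_of_exists_lift (hB : ExtZero R M B 1)
    (h : ∀ u : M →ₗ[R] C, ∃ v : M →ₗ[R] B, g ∘ₗ v = u) : ExtZero R M A 1 := by
  have hS := linearShortComplex_shortExact hf hfg hg
  refine subsingleton_of_forall_eq 0 fun x ↦ ?_
  obtain ⟨y, rfl⟩ := Ext.covariant_sequence_exact₁ (ModuleCat.of R M) hS x
    (hB.eq_zero _) (n₀ := 0) rfl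
  obtain ⟨u, rfl⟩ := Ext.addEquiv₀.symm.surjective y
  obtain ⟨v, hv⟩ := h u.hom
  have : u = ModuleCat.ofHom v ≫ ModuleCat.ofHom g := by
    ext1; exact hv.symm
  subst this
  change (Ext.mk₀ _).comp hS.extClass rfl = 0
  rw [← Ext.mk₀_comp_mk₀, Ext.comp_assoc_of_second_deg_zero]
  exact (congrArg (fun z ↦ (Ext.mk₀ (ModuleCat.ofHom v)).comp z (zero_add 1))
    hS.comp_extClass).trans (Ext.comp_zero _ _ _ _ _)

lemma extZero_left (i : ℕ) (hC : ExtZero R M C i) (hB : ExtZero R M B (i + 1)) :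
    ExtZero R M A (i + 1) := by
  have hS := linearShortComplex_shortExact hf hfg hg
  refine subsingleton_of_forall_eq 0 fun x ↦ ?_
  obtain ⟨y, rfl⟩ := Ext.covariant_sequence_exact₁ (ModuleCat.of R M) hS x
    (hB.eq_zero _) (n₀ := i) rfl
  rw [hC.eq_zero y, Ext.zero_comp]

lemma extZero_right (i : ℕ) (hB : ExtZero R M B i) (hA : ExtZero R M A (i + 1)) :
    ExtZero R M C i := by
  have hS := linearShortComplex_shortExact hf hfg hg
  refine subsingleton_of_forall_eq 0 fun x ↦ ?_
  obtain ⟨y, rfl⟩ := Ext.covariant_sequence_exact₃ (ModuleCat.of R M) hS x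
    (n₁ := i + 1) rfl (hA.eq_zero _)
  rw [hB.eq_zero y, Ext.zero_comp]

lemma ExtVanishes.quotient (hB : ExtVanishes R M B) (hA : ExtVanishes R M A) :
    ExtVanishes R M C :=
  fun i ↦ extZero_right hf hfg hg (i + 1) (hB i) (hA (i + 1))

end Covariant

lemma ExtZero.of_sum {ι : Type} [Fintype ι] {C : Type} [AddCommGroup C] [Module R C]
    (p : ι → C →ₗ[R] N) (j : ι → N →ₗ[R] C) (hs : ∑ a, j a ∘ₗ p a = LinearMap.id) {i : ℕ}
    (h : ExtZero R M N i) : ExtZero R M C i := by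
  refine subsingleton_of_forall_eq 0 fun x ↦ ?_
  have h1 : x = x.comp (Ext.mk₀ (ModuleCat.ofHom (∑ a, j a ∘ₗ p a))) (add_zero i) := by
    rw [hs]; exact (Ext.comp_mk₀_id x).symm
  have h2 : ModuleCat.ofHom (∑ a, j a ∘ₗ p a) =
      ∑ a, ModuleCat.ofHom (p a) ≫ ModuleCat.ofHom (j a) := by
    ext1; simp [ModuleCat.hom_sum]
  rw [h1, h2, Ext.mk₀_sum, Ext.comp_sum]
  refine Finset.sum_eq_zero fun a _ ↦ ?_
  rw [← Ext.mk₀_comp_mk₀, ← Ext.comp_assoc_of_second_deg_zero, h.eq_zero (x.comp _ _),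
    Ext.zero_comp]

lemma ExtVanishes.of_retract {C : Type} [AddCommGroup C] [Module R C] (h : ExtVanishes R M N)
    (p : C →ₗ[R] N) (j : N →ₗ[R] C) (hs : j ∘ₗ p = LinearMap.id) : ExtVanishes R M C :=
  fun i ↦ ExtZero.of_sum (ι := Unit) (fun _ ↦ p) (fun _ ↦ j) (by simpa) (h i)

lemma ExtVanishes.pi (h : ExtVanishes R M N) (n : ℕ) : ExtVanishes R M (Fin n → N) :=
  fun i ↦ ExtZero.of_sum (fun a ↦ LinearMap.proj a)
    (fun a ↦ LinearMap.single R (fun _ ↦ N) a)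
    (LinearMap.ext fun x ↦ by simpa using Finset.univ_sum_single x) (h i)

end ExtModules

section Syzygies

variable {R : Type} [CommRing R] {F M N : Type}
  [AddCommGroup F] [Module R F] [AddCommGroup M] [Module R M] [AddCommGroup N] [Module R N]

lemma ExtVanishes.of_projective (h : ExtVanishes R M R) (P : Type) [AddCommGroup P] [Module R P]
    [Module.Finite R P] [Module.Projective R P] : ExtVanishes R M P := by
  obtain ⟨n, f, hf⟩ := Module.Finite.exists_fin' R P
  obtain ⟨g, hg⟩ := Module.projective_lifting_property f LinearMap.id hf
  exact (h.pi n).of_retract g f hg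

lemma ExtVanishes.ker_self [Module.Finite R F] [Module.Projective R F] {g : F →ₗ[R] M}
    (hg : Function.Surjective g) (hM : ExtVanishes R M M) (hR : ExtVanishes R M R) :
    ExtVanishes R (LinearMap.ker g) (LinearMap.ker g) := by
  have hi : Function.Injective (LinearMap.ker g).subtype := Subtype.val_injective
  have he : Function.Exact (LinearMap.ker g).subtype g := LinearMap.exact_subtype_ker_map g
  have hKF := (hR.syzygy hi he hg).of_projective F
  have hKM := hM.syzygy hi he hg
  intro i
  cases i with
  | zero =>
    refine extZero_one_of_exists_lift hi he hg (hKF 0) fun u ↦ ?_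
    obtain ⟨v, hv⟩ := (hM 0).exists_extension hi he hg u
    obtain ⟨w, hw⟩ := Module.projective_lifting_property g v hg
    exact ⟨w ∘ₗ (LinearMap.ker g).subtype, by rw [← LinearMap.comp_assoc, hw, hv]⟩
  | succ i => exact extZero_left hi he hg _ (hKM i) (hKF (i + 1))

lemma ExtVanishes.projective_of_ker [Module.Projective R F] {g : F →ₗ[R] M}
    (hg : Function.Surjective g) (hR : ExtVanishes R M R) [Module.Finite R (LinearMap.ker g)]
    [Module.Projective R (LinearMap.ker g)] : Module.Projective R M := by
  obtain ⟨s, hs⟩ := ((hR.of_projective (LinearMap.ker g)) 0).exists_lift Subtype.val_injective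
    (LinearMap.exact_subtype_ker_map g) hg (LinearMap.id : M →ₗ[R] M)
  exact Module.Projective.of_split s g hs

lemma hasProjectiveDimensionLE_of_hasPdLE (k : ℕ) (M : Type) [AddCommGroup M] [Module R M]
    (h : hasPdLE R k M) : HasProjectiveDimensionLT (ModuleCat.of R M) (k + 1) := by
  induction k generalizing M with
  | zero =>
    have : Module.Projective R M := h
    exact projective_iff_hasProjectiveDimensionLT_one.mp inferInstance
  | succ k ih =>
    obtain ⟨P, _, _, f, _, hf, hk⟩ := h
    have hS := linearShortComplex_shortExact Subtype.val_injective
      (LinearMap.exact_subtype_ker_map f) hf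
    have : Projective (ModuleCat.of R P) := inferInstance
    exact (hS.hasProjectiveDimensionLT_X₃_iff k this).mpr (ih _ hk)

lemma ExtVanishes.projective_of_hasProjectiveDimensionLT [IsNoetherianRing R] (k : ℕ) (M : Type)
    [AddCommGroup M] [Module R M] [Module.Finite R M] (hR : ExtVanishes R M R)
    (h : HasProjectiveDimensionLT (ModuleCat.of R M) (k + 1)) : Module.Projective R M := by
  induction k generalizing M with
  | zero =>
    rw [zero_add, ← projective_iff_hasProjectiveDimensionLT_one, ← IsProjective.iff_projective] at h
    exact h
  | succ k ih =>
    obtain ⟨n, f, hf⟩ := Module.Finite.exists_fin' R M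
    have he := LinearMap.exact_subtype_ker_map f
    have hS := linearShortComplex_shortExact Subtype.val_injective he hf
    have : Projective (ModuleCat.of R (Fin n → R)) := inferInstance
    have := ih (LinearMap.ker f) (hR.syzygy Subtype.val_injective he hf)
      ((hS.hasProjectiveDimensionLT_X₃_iff k this).mp h)
    exact hR.projective_of_ker hf

lemma ExtVanishes.projective_of_hasPdLE [IsNoetherianRing R] [Module.Finite R M]
    (hR : ExtVanishes R M R) (k : ℕ) (h : hasPdLE R k M) : Module.Projective R M :=
  hR.projective_of_hasProjectiveDimensionLT k M (hasProjectiveDimensionLE_of_hasPdLE k M h)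

lemma LocalizedModule.exact_map (S : Submonoid R) {A B C : Type} [AddCommGroup A] [Module R A]
    [AddCommGroup B] [Module R B] [AddCommGroup C] [Module R C] {f : A →ₗ[R] B} {g : B →ₗ[R] C}
    (h : Function.Exact f g) : Function.Exact (LocalizedModule.map S f) (LocalizedModule.map S g) :=
  LocalizedModule.map_exact S f g h

lemma ExtZero.localizedModule [IsNoetherianRing R] (S : Submonoid R) (i : ℕ) (M : Type)
    [AddCommGroup M] [Module R M] [Module.Finite R M] (h : ExtZero R M N (i + 1)) :
    ExtZero (Localization S) (LocalizedModule S M) (LocalizedModule S N) (i + 1) := by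
  obtain ⟨n, g, hg⟩ := Module.Finite.exists_fin' R M
  have hi : Function.Injective (LinearMap.ker g).subtype := Subtype.val_injective
  have he := LinearMap.exact_subtype_ker_map g
  have hi' := LocalizedModule.map_injective S _ hi
  have hg' := LocalizedModule.map_surjective S _ hg
  have he' := LocalizedModule.exact_map S he
  have : Module.Projective (Localization S) (LocalizedModule S (Fin n → R)) :=
    Module.projective_of_isLocalizedModule S (LocalizedModule.mkLinearMap S (Fin n → R))
  induction i generalizing M n with
  | zero =>
    refine extZero_one_of_exists_extension hi' he' hg' fun u ↦ ?_
    have : Module.FinitePresentation R (LinearMap.ker g) :=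
      Module.finitePresentation_of_finite R _
    obtain ⟨⟨u', s⟩, hu'⟩ := IsLocalizedModule.surj S
      (LocalizedModule.map S (M := LinearMap.ker g) (N := N)) u
    obtain ⟨v, rfl⟩ := h.exists_extension hi he hg u'
    refine ⟨Localization.mk 1 s • LocalizedModule.map S v, ?_⟩
    ext1 x
    have h1 : LocalizedModule.map S v (LocalizedModule.map S (LinearMap.ker g).subtype x) =
        LocalizedModule.map S (v ∘ₗ (LinearMap.ker g).subtype) x := by
      induction x with | _ a b => simp
    have h2 : LocalizedModule.map S (v ∘ₗ (LinearMap.ker g).subtype) x = (s : R) • u x :=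
      (LinearMap.congr_fun hu' x).symm
    have h3 : (Localization.mk 1 s : Localization S) * algebraMap R _ (s : R) = 1 := by
      rw [← Localization.mk_one_eq_algebraMap, Localization.mk_mul]
      simpa using Localization.mk_self s
    simp only [LinearMap.comp_apply, LinearMap.smul_apply]
    rw [h1, h2, ← algebraMap_smul (Localization S) (s : R) (u x), smul_smul, h3, one_smul]
  | succ i ih =>
    have h' := (extZero_succ_succ_iff hi he hg i).mp h
    refine (extZero_succ_succ_iff hi' he' hg' i).mpr ?_
    obtain ⟨m, f, hf⟩ := Module.Finite.exists_fin' R (LinearMap.ker g)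
    refine ih (LinearMap.ker g) h' m f hf Subtype.val_injective
      (LinearMap.exact_subtype_ker_map f) (LocalizedModule.map_injective S _ Subtype.val_injective)
      (LocalizedModule.map_surjective S _ hf)
      (LocalizedModule.exact_map S (LinearMap.exact_subtype_ker_map f)) ?_
    exact Module.projective_of_isLocalizedModule S (LocalizedModule.mkLinearMap S (Fin m → R))

lemma ExtVanishes.localizedModule [IsNoetherianRing R] [Module.Finite R M] (S : Submonoid R)
    (h : ExtVanishes R M N) :
    ExtVanishes (Localization S) (LocalizedModule S M) (LocalizedModule S N) :=
  fun i ↦ (h i).localizedModule S i M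

lemma ExtVanishes.localizedModule_self [IsNoetherianRing R] [Module.Finite R M] (S : Submonoid R)
    (h : ExtVanishes R M R) :
    ExtVanishes (Localization S) (LocalizedModule S M) (Localization S) := by
  refine (h.localizedModule S).of_retract (C := Localization S) (LocalizedModule.map S LinearMap.id)
    (LocalizedModule.map S LinearMap.id) ?_
  simp

end Syzygies

section RegularSequences

open RingTheory.Sequence Submodule
open scoped Pointwise

variable {R : Type} [CommRing R]

lemma QuotSMulTop.map_injective {A B C : Type} [AddCommGroup A] [Module R A]
    [AddCommGroup B] [Module R B] [AddCommGroup C] [Module R C] {f : A →ₗ[R] B} {g : B →ₗ[R] C}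
    (hf : Function.Injective f) (hfg : Function.Exact f g) {r : R} (hr : IsSMulRegular C r) :
    Function.Injective (QuotSMulTop.map r f) := by
  rw [injective_iff_map_eq_zero]
  intro a' ha
  obtain ⟨a, rfl⟩ := Submodule.mkQ_surjective _ a'
  rw [Submodule.mkQ_apply, QuotSMulTop.map_apply_mk, Submodule.Quotient.mk_eq_zero,
    mem_smul_pointwise_iff_exists] at ha
  obtain ⟨b, -, hb⟩ := ha
  have h0 : g b = 0 := hr.right_eq_zero_of_smul (by
    rw [← map_smul, hb, hfg.apply_apply_eq_zero])
  obtain ⟨a₁, rfl⟩ := (hfg b).mp h0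
  rw [← map_smul] at hb
  rw [← hf hb, Submodule.mkQ_apply, Submodule.Quotient.mk_eq_zero]
  exact Submodule.smul_mem_pointwise_smul _ _ _ trivial

lemma mk_mem_ofList_smul_top {N : Type} [AddCommGroup N] [Module R N] {r : R} {rs : List R} {x : N}
    (hx : x ∈ (Ideal.ofList (r :: rs) • ⊤ : Submodule R N)) :
    (Submodule.Quotient.mk x : QuotSMulTop r N) ∈
      (Ideal.ofList rs • ⊤ : Submodule R (QuotSMulTop r N)) := by
  have h : (Submodule.Quotient.mk x : QuotSMulTop r N) ∈
      Submodule.map (mkQ (r • ⊤ : Submodule R N)) (Ideal.ofList (r :: rs) • ⊤) := mem_map_of_mem hx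
  rw [Ideal.ofList_cons_smul, Submodule.map_sup, map_smul'', Submodule.map_top, range_mkQ] at h
  have h0 : Submodule.map (mkQ (r • ⊤ : Submodule R N)) (r • ⊤) = ⊥ := by
    rw [eq_bot_iff, map_le_iff_le_comap, comap_bot, ker_mkQ]
  rwa [h0, bot_sup_eq] at h

lemma exists_sub_mem_of_mk_mem_ofList_smul_top {N : Type} [AddCommGroup N] [Module R N] {r : R}
    {rs : List R} {x : N} (hx : (Submodule.Quotient.mk x : QuotSMulTop r N) ∈
      (Ideal.ofList rs • ⊤ : Submodule R (QuotSMulTop r N))) :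
    x ∈ (Ideal.ofList (r :: rs) • ⊤ : Submodule R N) := by
  rw [← range_mkQ, ← Submodule.map_top, ← map_smul''] at hx
  obtain ⟨y, hy, hxy⟩ := hx
  rw [Submodule.mkQ_apply, Submodule.Quotient.eq] at hxy
  rw [Ideal.ofList_cons_smul]
  rw [← sub_sub_cancel y x]
  exact sub_mem (mem_sup_right hy) (mem_sup_left hxy)

lemma QuotSMulTop.exact_smul_mkQ (N : Type) [AddCommGroup N] [Module R N] (r : R) :
    Function.Exact (LinearMap.lsmul R N r) (mkQ (r • ⊤ : Submodule R N)) := by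
  rw [LinearMap.exact_iff, ker_mkQ]
  ext x
  simp [mem_smul_pointwise_iff_exists]

lemma ExtVanishes.quotSMulTop {M N : Type} [AddCommGroup M] [Module R M] [AddCommGroup N]
    [Module R N] (h : ExtVanishes R M N) {r : R} (hr : IsSMulRegular N r) :
    ExtVanishes R M (QuotSMulTop r N) :=
  ExtVanishes.quotient (f := LinearMap.lsmul R N r) hr (QuotSMulTop.exact_smul_mkQ N r)
    (mkQ_surjective _) h h

lemma ExtVanishes.exists_lift_of_isWeaklyRegular {M N Q : Type} [AddCommGroup M] [Module R M]
    [AddCommGroup N] [Module R N] [AddCommGroup Q] [Module R Q] (h : ExtVanishes R M N)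
    {rs : List R} (hrs : IsWeaklyRegular N rs) {q : N →ₗ[R] Q} (hq : Function.Surjective q)
    (hker : LinearMap.ker q = Ideal.ofList rs • ⊤) (u : M →ₗ[R] Q) :
    ∃ v : M →ₗ[R] N, q ∘ₗ v = u := by
  induction rs generalizing N with
  | nil =>
    have hi : Function.Injective q := by
      rw [← LinearMap.ker_eq_bot, hker, Ideal.ofList_nil, Submodule.bot_smul]
    exact ⟨(LinearEquiv.ofBijective q ⟨hi, hq⟩).symm.toLinearMap ∘ₗ u, by
      ext x; exact (LinearEquiv.ofBijective q ⟨hi, hq⟩).apply_symm_apply (u x)⟩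
  | cons r rs ih =>
    rw [isWeaklyRegular_cons_iff] at hrs
    have hle : r • ⊤ ≤ LinearMap.ker q := by
      rw [hker, Ideal.ofList_cons_smul]; exact le_sup_left
    obtain ⟨v, hv⟩ := ih (h.quotSMulTop hrs.1) hrs.2 (q := (r • ⊤ : Submodule R N).liftQ q hle)
      (by rw [← LinearMap.range_eq_top, range_liftQ, LinearMap.range_eq_top.mpr hq]) (by
        ext x
        obtain ⟨x, rfl⟩ := mkQ_surjective _ x
        rw [LinearMap.mem_ker, mkQ_apply, liftQ_apply, ← LinearMap.mem_ker, hker]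
        exact ⟨mk_mem_ofList_smul_top, exists_sub_mem_of_mk_mem_ofList_smul_top⟩)
    obtain ⟨w, hw⟩ := (h 0).exists_lift (f := LinearMap.lsmul R N r) hrs.1
      (QuotSMulTop.exact_smul_mkQ N r) (mkQ_surjective _) v
    exact ⟨w, by rw [← hv, ← hw, ← LinearMap.comp_assoc, liftQ_mkQ]⟩

lemma ExtVanishes.mem_ofList_smul_top_hom {M N : Type} [AddCommGroup M] [Module R M]
    [AddCommGroup N] [Module R N] (h : ExtVanishes R M N) {rs : List R}
    (hrs : IsWeaklyRegular N rs) (α : M →ₗ[R] N)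
    (hα : ∀ y, α y ∈ (Ideal.ofList rs • ⊤ : Submodule R N)) :
    α ∈ (Ideal.ofList rs • ⊤ : Submodule R (M →ₗ[R] N)) := by
  induction rs generalizing N with
  | nil =>
    have : α = 0 := by ext y; simpa using hα y
    rw [this]; exact zero_mem _
  | cons r rs ih =>
    rw [isWeaklyRegular_cons_iff] at hrs
    have h1 := ih (h.quotSMulTop hrs.1) hrs.2 (mkQ (r • ⊤ : Submodule R N) ∘ₗ α)
      (fun y ↦ mk_mem_ofList_smul_top (hα y))
    have hsurj : LinearMap.range (LinearMap.compRight R (mkQ (r • ⊤ : Submodule R N)) (M := M)) =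
        ⊤ := by
      rw [LinearMap.range_eq_top]
      exact fun u ↦ (h 0).exists_lift (f := LinearMap.lsmul R N r) hrs.1
        (QuotSMulTop.exact_smul_mkQ N r) (mkQ_surjective _) u
    rw [← hsurj, ← Submodule.map_top, ← map_smul''] at h1
    obtain ⟨β, hβ, hαβ⟩ := h1
    have h2 : ∀ y, ∃ z, r • z = (α - β) y := fun y ↦ by
      have := LinearMap.congr_fun hαβ y
      exact (QuotSMulTop.exact_smul_mkQ N r _).mp (by
        rw [LinearMap.sub_apply, map_sub]; exact sub_eq_zero.mpr this.symm)
    choose γ hγ using h2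
    have h3 : α - β = r • (⟨⟨γ, fun x y ↦ hrs.1 (by simp [hγ]; abel)⟩, fun c x ↦ hrs.1 (by
      dsimp only; rw [smul_comm r, hγ, hγ]; simp [smul_sub])⟩ : M →ₗ[R] N) := by
      ext y; exact (hγ y).symm
    rw [← sub_add_cancel α β, h3, Ideal.ofList_cons_smul]
    exact add_mem (mem_sup_left (Submodule.smul_mem_pointwise_smul _ _ _ trivial))
      (mem_sup_right hβ)

section Exact

lemma isWeaklyRegular_append_of_exact {A B C : Type} [AddCommGroup A] [Module R A]
    [AddCommGroup B] [Module R B] [AddCommGroup C] [Module R C] {f : A →ₗ[R] B} {g : B →ₗ[R] C}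
    (hf : Function.Injective f) (hfg : Function.Exact f g) (hg : Function.Surjective g)
    (rs : List R) (y : R) (hB : IsWeaklyRegular B (rs ++ [y])) (hC : IsWeaklyRegular C rs) :
    IsWeaklyRegular A (rs ++ [y]) := by
  induction rs generalizing A B C with
  | nil =>
    rw [List.nil_append, isWeaklyRegular_singleton_iff] at hB ⊢
    exact hB.of_injective f hf
  | cons r rs ih =>
    rw [List.cons_append, isWeaklyRegular_cons_iff] at hB ⊢
    rw [isWeaklyRegular_cons_iff] at hC
    exact ⟨hB.1.of_injective f hf, ih (QuotSMulTop.map_injective hf hfg hC.1)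
      (QuotSMulTop.map_exact r hfg hg) (QuotSMulTop.map_surjective r hg) hB.2 hC.2⟩

lemma mem_ofList_smul_top_of_exact {A B C : Type} [AddCommGroup A] [Module R A]
    [AddCommGroup B] [Module R B] [AddCommGroup C] [Module R C] {f : A →ₗ[R] B} {g : B →ₗ[R] C}
    (hf : Function.Injective f) (hfg : Function.Exact f g) (hg : Function.Surjective g)
    (rs : List R) (hC : IsWeaklyRegular C rs) (a : A)
    (ha : f a ∈ (Ideal.ofList rs • ⊤ : Submodule R B)) :
    a ∈ (Ideal.ofList rs • ⊤ : Submodule R A) := by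
  induction rs generalizing A B C with
  | nil =>
    rw [Ideal.ofList_nil, Submodule.bot_smul, Submodule.mem_bot] at ha ⊢
    exact hf (by rw [ha, map_zero])
  | cons r rs ih =>
    rw [isWeaklyRegular_cons_iff] at hC
    refine exists_sub_mem_of_mk_mem_ofList_smul_top
      (ih (QuotSMulTop.map_injective hf hfg hC.1)
      (QuotSMulTop.map_exact r hfg hg) (QuotSMulTop.map_surjective r hg) hC.2 _ ?_)
    rw [QuotSMulTop.map_apply_mk]
    exact mk_mem_ofList_smul_top ha

end Exact

end RegularSequences

section Trace

open RingTheory.Sequence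

variable {R : Type} [CommRing R] {M : Type} [AddCommGroup M] [Module R M]

/-- Multiplication by `a` on `M` factors through a finite free module. -/
def SMulFactorsThroughFree (R : Type) [CommRing R] (M : Type) [AddCommGroup M] [Module R M]
    (a : R) : Prop :=
  ∃ (n : ℕ) (s : M →ₗ[R] (Fin n → R)) (t : (Fin n → R) →ₗ[R] M), ∀ y, t (s y) = a • y

lemma SMulFactorsThroughFree.ker {a : R} (h : SMulFactorsThroughFree R M a) {m : ℕ}
    {f : (Fin m → R) →ₗ[R] M} (hf : Function.Surjective f) :
    SMulFactorsThroughFree R (LinearMap.ker f) a := by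
  obtain ⟨n, s, t, hst⟩ := h
  obtain ⟨t', ht'⟩ := Module.projective_lifting_property f t hf
  have hmem : ∀ x, (a • (LinearMap.id : (Fin m → R) →ₗ[R] _) - t' ∘ₗ s ∘ₗ f) x ∈ LinearMap.ker f := fun x ↦ by
    have : f (t' (s (f x))) = t (s (f x)) := LinearMap.congr_fun ht' _
    simp [this, hst]
  refine ⟨m, (LinearMap.ker f).subtype, LinearMap.codRestrict _ _ hmem, fun y ↦ Subtype.ext ?_⟩
  simp

lemma trace_mem_of_mem_smul_top {a b : R} (ha : IsSMulRegular R a)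
    (hab : ∀ c, a ∣ b * c → a ∣ c) (hMa : SMulFactorsThroughFree R M a)
    (hMb : SMulFactorsThroughFree R M b) {n : ℕ} (σ : M →ₗ[R] (Fin n → R))
    (τ : (Fin n → R) →ₗ[R] M) (I : Ideal R) (h : τ ∘ₗ σ ∈ (I • ⊤ : Submodule R (M →ₗ[R] M))) :
    LinearMap.trace R _ (σ ∘ₗ τ) ∈ I := by
  obtain ⟨k, s, t, hst⟩ := hMa
  obtain ⟨l, s', t', hst'⟩ := hMb
  have hst₁ : t ∘ₗ s = a • LinearMap.id := LinearMap.ext hst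
  have hst₂ : t' ∘ₗ s' = b • LinearMap.id := LinearMap.ext hst'
  have hdvd : ∀ β : M →ₗ[R] M, a ∣ LinearMap.trace R _ (s ∘ₗ β ∘ₗ t) := by
    intro β
    refine hab _ ⟨LinearMap.trace R _ (s' ∘ₗ β ∘ₗ t'), ?_⟩
    have h1 := LinearMap.trace_comp_comm' (R := R) (s' ∘ₗ β ∘ₗ t) (s ∘ₗ t')
    have e1 : (s ∘ₗ t') ∘ₗ (s' ∘ₗ β ∘ₗ t) = b • (s ∘ₗ β ∘ₗ t) := by
      refine LinearMap.ext fun x ↦ ?_; simp [hst']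
    have e2 : (s' ∘ₗ β ∘ₗ t) ∘ₗ (s ∘ₗ t') = a • (s' ∘ₗ β ∘ₗ t') := by
      refine LinearMap.ext fun x ↦ ?_; simp [hst]
    rwa [e1, e2, map_smul, map_smul, smul_eq_mul, smul_eq_mul] at h1
  have hI : ∃ c ∈ I, LinearMap.trace R _ (s ∘ₗ (τ ∘ₗ σ) ∘ₗ t) = a * c := by
    refine Submodule.smul_induction_on
      (p := fun β ↦ ∃ c ∈ I, LinearMap.trace R _ (s ∘ₗ β ∘ₗ t) = a * c) h ?_ ?_
    · intro r hr β _
      obtain ⟨c, hc⟩ := hdvd β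
      refine ⟨r * c, I.mul_mem_right _ hr, ?_⟩
      have : s ∘ₗ (r • β) ∘ₗ t = r • (s ∘ₗ β ∘ₗ t) := by refine LinearMap.ext fun x ↦ ?_; simp
      rw [this, map_smul, hc, smul_eq_mul]; ring
    · rintro β γ ⟨c, hc, hβ⟩ ⟨d, hd, hγ⟩
      refine ⟨c + d, I.add_mem hc hd, ?_⟩
      have : s ∘ₗ (β + γ) ∘ₗ t = s ∘ₗ β ∘ₗ t + s ∘ₗ γ ∘ₗ t := by refine LinearMap.ext fun x ↦ ?_; simp
      rw [this, map_add, hβ, hγ]; ring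
  obtain ⟨c, hc, h1⟩ := hI
  have h2 := LinearMap.trace_comp_comm' (R := R) (σ ∘ₗ t) (s ∘ₗ τ)
  have e1 : (s ∘ₗ τ) ∘ₗ σ ∘ₗ t = s ∘ₗ (τ ∘ₗ σ) ∘ₗ t := rfl
  have e2 : (σ ∘ₗ t) ∘ₗ s ∘ₗ τ = a • (σ ∘ₗ τ) := by
    refine LinearMap.ext fun x ↦ ?_; simp [hst]
  rw [e1, e2, h1, map_smul] at h2
  have : c = LinearMap.trace R _ (σ ∘ₗ τ) := ha h2
  rwa [← this]

end Trace

section LocalCriterion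

open RingTheory.Sequence

variable {R : Type} [CommRing R] [IsLocalRing R] {M : Type} [AddCommGroup M] [Module R M]

lemma exists_minimal_generators [Module.Finite R M] :
    ∃ (n : ℕ) (m : Fin n → M) (l : Fin n → M →ₗ[R] ResidueField R),
      Submodule.span R (Set.range m) = ⊤ ∧ ∀ i j, l i (m j) = if i = j then 1 else 0 := by
  let b := Module.finBasis (ResidueField R) (ResidueField R ⊗[R] M)
  have hsurj := TensorProduct.mk_surjective R M (ResidueField R) Ideal.Quotient.mk_surjective
  choose m hm using fun i ↦ hsurj (b i)
  refine ⟨_, m, fun i ↦ (b.coord i).restrictScalars R ∘ₗ TensorProduct.mk R (ResidueField R) M 1,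
    span_eq_top_of_tmul_eq_basis m b hm, fun i j ↦ ?_⟩
  simp only [LinearMap.comp_apply, LinearMap.restrictScalars_apply, hm]
  simp [Finsupp.single_apply, eq_comm]

lemma ExtVanishes.mem_of_socle {rs : List R} (hR : ExtVanishes R M R)
    (hM : ExtVanishes R M M) (hrsR : IsWeaklyRegular R rs) (hrsM : IsWeaklyRegular M rs)
    {a b : R} (ha : IsSMulRegular R a)
    (hab : ∀ c, a ∣ b * c → a ∣ c) (hMa : SMulFactorsThroughFree R M a)
    (hMb : SMulFactorsThroughFree R M b) {n : ℕ} (τ : (Fin n → R) →ₗ[R] M)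
    (l : M →ₗ[R] ResidueField R) (s : Fin n → R) (hs : τ s = 0)
    (hsoc : ∀ r ∈ maximalIdeal R, ∀ i, r * s i ∈ Ideal.ofList rs) (i : Fin n)
    (hl : ∀ j, l (τ (Pi.single j 1)) = if i = j then 1 else 0) : s i ∈ Ideal.ofList rs := by
  set I := Ideal.ofList rs with hI
  let ψ : Fin n → (R ⧸ maximalIdeal R) →ₗ[R] (R ⧸ I) := fun j ↦
    (maximalIdeal R).liftQ (I.mkQ ∘ₗ LinearMap.toSpanSingleton R R (s j)) fun r hr ↦ by
      have := hsoc r hr j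
      exact Ideal.Quotient.eq_zero_iff_mem.mpr this
  have hlift : ∀ j, ∃ g : M →ₗ[R] R, I.mkQ ∘ₗ g = ψ j ∘ₗ l := fun j ↦
    hR.exists_lift_of_isWeaklyRegular hrsR I.mkQ_surjective (by simp [hI]) _
  choose g hg using hlift
  have hg' : ∀ y c, l y = Ideal.Quotient.mk _ c → ∀ j, g j y - c * s j ∈ I := fun y c hc j ↦ by
    have : I.mkQ (g j y) = ψ j (l y) := LinearMap.congr_fun (hg j) y
    rw [hc] at this
    exact (Ideal.Quotient.eq).mp this
  have hτ : ∀ c, τ c = ∑ j, c j • τ (Pi.single j 1) := fun c ↦ by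
    conv_lhs => rw [pi_eq_sum_univ' c]
    simp
  have hmem := hM.mem_ofList_smul_top_hom hrsM (τ ∘ₗ LinearMap.pi g) fun y ↦ by
    obtain ⟨c, hc⟩ := Ideal.Quotient.mk_surjective (I := maximalIdeal R) (l y)
    have h1 : τ (LinearMap.pi g y) = τ (LinearMap.pi g y - c • s) := by simp [hs]
    rw [LinearMap.comp_apply, h1, hτ]
    exact Submodule.sum_mem _ fun j _ ↦ Submodule.smul_mem_smul (hg' y c hc.symm j) trivial
  have htr := trace_mem_of_mem_smul_top ha hab hMa hMb (LinearMap.pi g) τ I hmem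
  rw [LinearMap.trace_eq_matrix_trace R (Pi.basisFun R (Fin n)), Matrix.trace] at htr
  simp only [Matrix.diag_apply, LinearMap.toMatrix_apply, Pi.basisFun_apply, Pi.basisFun_repr,
    LinearMap.comp_apply, LinearMap.pi_apply] at htr
  have h2 : ∑ j, (g j (τ (Pi.single j 1)) - (if i = j then 1 else 0) * s j) ∈ I :=
    Ideal.sum_mem _ fun j _ ↦ hg' _ _ (by rw [hl]; split_ifs <;> rfl) j
  rw [Finset.sum_sub_distrib] at h2
  have := (Submodule.sub_mem_iff_right _ htr).mp h2
  simpa using this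

theorem ExtVanishes.free_of_isWeaklyRegular [IsNoetherianRing R] [Module.Finite R M] {rs : List R}
    (hR : ExtVanishes R M R)
    (hM : ExtVanishes R M M) (hrsR : IsWeaklyRegular R rs) (hrsM : IsWeaklyRegular M rs)
    (hle : Ideal.ofList rs ≤ maximalIdeal R) {N : ℕ} (hN : maximalIdeal R ^ N ≤ Ideal.ofList rs)
    {a b : R} (ha : IsSMulRegular R a)
    (hab : ∀ c, a ∣ b * c → a ∣ c) (hMa : SMulFactorsThroughFree R M a)
    (hMb : SMulFactorsThroughFree R M b) : Module.Projective R M := by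
  obtain ⟨n, m, l, hm, hl⟩ := exists_minimal_generators (R := R) (M := M)
  let τ : (Fin n → R) →ₗ[R] M := Fintype.linearCombination R m
  have hτ : Function.Surjective τ := by
    rw [← LinearMap.range_eq_top, Fintype.range_linearCombination, hm]
  have key : ∀ j, ∀ s : Fin n → R, τ s = 0 →
      (∀ r ∈ maximalIdeal R ^ j, ∀ i, r * s i ∈ Ideal.ofList rs) →
      ∀ i, s i ∈ Ideal.ofList rs := by
    intro j
    induction j with
    | zero => intro s _ h i; simpa using h 1 (by simp) i
    | succ j ih =>
      intro s hs h i
      refine hR.mem_of_socle hM hrsR hrsM ha hab hMa hMb τ (l i) s hs (fun r hr ↦ ?_) i fun j ↦ by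
        simp [τ, hl]
      refine ih (r • s) (by simp [hs]) fun r' hr' i ↦ ?_
      have := h (r' * r) (by rw [pow_succ]; exact Ideal.mul_mem_mul hr' hr) i
      rwa [mul_assoc] at this
  have hker : LinearMap.ker τ = ⊥ := by
    have h1 : (⊤ : Submodule R (LinearMap.ker τ)) ≤ Ideal.ofList rs • ⊤ := by
      intro s _
      refine mem_ofList_smul_top_of_exact Subtype.val_injective (LinearMap.exact_subtype_ker_map τ)
        hτ rs hrsM s ?_
      have h2 := key N s.1 s.2 fun r hr i ↦ Ideal.mul_mem_right _ _ (hN hr)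
      rw [Submodule.subtype_apply, pi_eq_sum_univ' s.1]
      exact Submodule.sum_mem _ fun i _ ↦ Submodule.smul_mem_smul (h2 i) trivial
    have h2 := Submodule.eq_bot_of_le_smul_of_le_jacobson_bot _ _
      (Module.Finite.fg_top) h1 (hle.trans (maximalIdeal_le_jacobson _))
    rw [Submodule.eq_bot_iff]
    intro s hs
    have h3 : (⟨s, hs⟩ : LinearMap.ker τ) ∈ (⊥ : Submodule R (LinearMap.ker τ)) := h2 ▸ trivial
    exact congrArg Subtype.val ((Submodule.mem_bot R).mp h3)
  exact Module.Projective.of_equiv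
    (LinearEquiv.ofBijective τ ⟨LinearMap.ker_eq_bot.mp hker, hτ⟩)

end LocalCriterion

section LocalFreeness

open RingTheory.Sequence

theorem ExtVanishes.projective_of_isWeaklyRegular {R : Type} [CommRing R] [IsLocalRing R]
    [IsNoetherianRing R] (rs₁ rs₂ : List R) {M : Type}
    [AddCommGroup M] [Module R M] [Module.Finite R M] (hR : ExtVanishes R M R)
    (hM : ExtVanishes R M M) (hrsR : IsWeaklyRegular R (rs₁ ++ rs₂))
    (hrsM : IsWeaklyRegular M rs₁) (hle : Ideal.ofList (rs₁ ++ rs₂) ≤ maximalIdeal R) {N : ℕ}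
    (hN : maximalIdeal R ^ N ≤ Ideal.ofList (rs₁ ++ rs₂)) {a b : R} (ha : IsSMulRegular R a)
    (hab : ∀ c, a ∣ b * c → a ∣ c) (hMa : SMulFactorsThroughFree R M a)
    (hMb : SMulFactorsThroughFree R M b) : Module.Projective R M := by
  induction rs₂ generalizing rs₁ M with
  | nil =>
    rw [List.append_nil] at *
    exact hR.free_of_isWeaklyRegular hM hrsR hrsM hle hN ha hab hMa hMb
  | cons y rs₂ ih =>
    rw [List.append_cons] at hrsR hle hN
    obtain ⟨n, f, hf⟩ := Module.Finite.exists_fin' R M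
    have hi : Function.Injective (LinearMap.ker f).subtype := Subtype.val_injective
    have he := LinearMap.exact_subtype_ker_map f
    have hF : IsWeaklyRegular (Fin n → R) (rs₁ ++ [y]) :=
      ((TensorProduct.lid R (Fin n → R)).isWeaklyRegular_congr _).mp
        (((isWeaklyRegular_append_iff R _ _).mp hrsR).1.isWeaklyRegular_rTensor)
    have := ih (rs₁ ++ [y]) (hR.syzygy hi he hf) (hM.ker_self hf hR) hrsR
      (isWeaklyRegular_append_of_exact hi he hf rs₁ y hF hrsM) hle hN (hMa.ker hf) (hMb.ker hf)
    exact hR.projective_of_ker hf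

end LocalFreeness

section FreenessIdeal

variable {R : Type} [CommRing R] {M : Type} [AddCommGroup M] [Module R M]

lemma SMulFactorsThroughFree.of_projective {P : Type} [AddCommGroup P] [Module R P]
    [Module.Finite R P] [Module.Projective R P] {a : R} (s : M →ₗ[R] P) (t : P →ₗ[R] M)
    (h : ∀ y, t (s y) = a • y) : SMulFactorsThroughFree R M a := by
  obtain ⟨n, f, hf⟩ := Module.Finite.exists_fin' R P
  obtain ⟨g, hg⟩ := Module.projective_lifting_property f LinearMap.id hf
  refine ⟨n, g ∘ₗ s, t ∘ₗ f, fun y ↦ ?_⟩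
  have : f (g (s y)) = s y := LinearMap.congr_fun hg _
  simp [this, h]

/-- The ideal of elements whose multiplication on `M` factors through a finite free module. -/
def freeFactorIdeal (R : Type) [CommRing R] (M : Type) [AddCommGroup M] [Module R M] : Ideal R where
  carrier := {a | SMulFactorsThroughFree R M a}
  zero_mem' := ⟨0, 0, 0, by simp⟩
  add_mem' := by
    rintro a b ⟨n, s, t, h⟩ ⟨m, s', t', h'⟩
    exact .of_projective (s.prod s') (t.coprod t') fun y ↦ by simp [h, h', add_smul]
  smul_mem' := by
    rintro c a ⟨n, s, t, h⟩
    exact ⟨n, s, c • t, fun y ↦ by simp [h, mul_smul]⟩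

lemma map_freeFactorIdeal_le (S : Submonoid R) :
    (freeFactorIdeal R M).map (algebraMap R (Localization S)) ≤
      freeFactorIdeal (Localization S) (LocalizedModule S M) := by
  rw [Ideal.map_le_iff_le_comap]
  rintro a ⟨n, s, t, h⟩
  refine SMulFactorsThroughFree.of_projective (LocalizedModule.map S s) (LocalizedModule.map S t)
    fun y ↦ ?_
  induction y using LocalizedModule.induction_on with
  | h y u => simp [LocalizedModule.map_mk, h, ← LocalizedModule.smul'_mk]

lemma exists_mem_freeFactorIdeal_notMem [IsNoetherianRing R] [Module.Finite R M] (q : Ideal R)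
    [q.IsPrime] [Module.Projective (Localization.AtPrime q) (LocalizedModule q.primeCompl M)] :
    ∃ a ∈ freeFactorIdeal R M, a ∉ q := by
  obtain ⟨n, f, hf⟩ := Module.Finite.exists_fin' R M
  obtain ⟨g, hg⟩ := Module.projective_lifting_property (LocalizedModule.map q.primeCompl f)
    LinearMap.id (LocalizedModule.map_surjective _ _ hf)
  have : Module.FinitePresentation R M := Module.finitePresentation_of_finite R M
  obtain ⟨s, u, hsu⟩ := Module.FinitePresentation.exists_lift_of_isLocalizedModule q.primeCompl
    (LocalizedModule.mkLinearMap q.primeCompl (Fin n → R))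
    (g.restrictScalars R ∘ₗ LocalizedModule.mkLinearMap q.primeCompl M)
  have h1 : LocalizedModule.mkLinearMap q.primeCompl M ∘ₗ f ∘ₗ s =
      LocalizedModule.mkLinearMap q.primeCompl M ∘ₗ (u • LinearMap.id) := by
    refine LinearMap.ext fun y ↦ ?_
    have h2 := congrArg (LocalizedModule.map q.primeCompl f) (LinearMap.congr_fun hsu y)
    have h3 : LocalizedModule.map q.primeCompl f (g (LocalizedModule.mk y 1)) =
      LocalizedModule.mk y 1 := LinearMap.congr_fun hg _
    simp only [LinearMap.comp_apply, LinearMap.smul_apply, LocalizedModule.mkLinearMap_apply,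
      LocalizedModule.map_mk, LinearMap.restrictScalars_apply] at h2 ⊢
    rw [h2, Submonoid.smul_def, Submonoid.smul_def, LinearMap.map_smul_of_tower, h3]
    simp [LocalizedModule.smul'_mk]
  obtain ⟨v, hv⟩ := Module.Finite.exists_smul_of_comp_eq_of_isLocalizedModule q.primeCompl
    (LocalizedModule.mkLinearMap q.primeCompl M) _ _ h1
  refine ⟨(v * u : q.primeCompl), ⟨n, s, (v : R) • f, fun y ↦ ?_⟩, (v * u).2⟩
  simpa [Submonoid.smul_def, mul_smul] using LinearMap.congr_fun hv y

end FreenessIdeal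

section CohenMacaulay

open RingTheory.Sequence

lemma IsCMLocal.exists_isRegular {S : Type} [CommRing S] [IsLocalRing S] [IsNoetherianRing S]
    (h : IsCMLocal S) {d : ℕ} (hd : ringKrullDim S = d) :
    ∃ rs : List S, rs.length = d ∧ (∀ r ∈ rs, r ∈ maximalIdeal S) ∧ IsRegular S rs := by
  have hdepth : moduleDepth S S = d := by
    have h' : (moduleDepth S S : WithBot ℕ∞) = ringKrullDim S := h
    rw [hd] at h'
    exact_mod_cast h'
  refine ModuleCat.exists_isRegular_of_exists_subsingleton_ext (maximalIdeal S) d (ModuleCat.of S S)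
    ?_ (ModuleCat.of S (S ⧸ maximalIdeal S)) ?_ fun k hk ↦ ?_
  · have hlt : (maximalIdeal S • ⊤ : Ideal S) < ⊤ := by
      rw [smul_eq_mul, Ideal.mul_top]
      exact (maximalIdeal.isMaximal S).ne_top.lt_top
    exact hlt
  · rw [Module.support_eq_zeroLocus, Ideal.annihilator_quotient]
  · have : Subsingleton (extGroup S k (S ⧸ maximalIdeal S) S) := by
      by_contra hc
      rw [not_subsingleton_iff_nontrivial] at hc
      have hle : moduleDepth S S ≤ k := sInf_le ⟨k, rfl, hc⟩
      rw [hdepth] at hle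
      exact absurd (by exact_mod_cast hle) hk.not_ge
    exact subsingleton_abelianExt_of_subsingleton_extGroup _ _ _

lemma exists_natCast_eq_ringKrullDim (S : Type) [CommRing S] [IsLocalRing S]
    [IsNoetherianRing S] : ∃ d : ℕ, ringKrullDim S = d := by
  rw [← maximalIdeal_height_eq_ringKrullDim]
  exact ⟨_, congrArg _ (ENat.natCast_toNat (Ideal.height_ne_top (Ideal.IsPrime.ne_top'))).symm⟩

lemma exists_maximalIdeal_pow_le_of_isRegular {S : Type} [CommRing S] [IsLocalRing S]
    [IsNoetherianRing S] {rs : List S} (hrs : IsRegular S rs)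
    (hd : ringKrullDim S = rs.length) : ∃ N, maximalIdeal S ^ N ≤ Ideal.ofList rs := by
  have h := ringKrullDim_add_length_eq_ringKrullDim_of_isRegular rs hrs
  set I := Ideal.ofList rs
  have hI : I ≠ ⊤ := fun hI ↦ hrs.top_ne_smul (by simpa using hI.symm)
  have : Nontrivial (S ⧸ I) := Ideal.Quotient.nontrivial_iff.mpr hI
  have : IsLocalRing (S ⧸ I) := .of_surjective' (Ideal.Quotient.mk I) Ideal.Quotient.mk_surjective
  have h0 : ringKrullDim (S ⧸ I) = 0 := by
    obtain ⟨e, he⟩ := exists_natCast_eq_ringKrullDim (S ⧸ I)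
    rw [hd, he] at h
    rw [he]
    norm_cast at h ⊢
    omega
  rw [← ringKrullDimZero_iff_ringKrullDim_eq_zero, ← isArtinianRing_iff_krullDimLE_zero,
    isArtinianRing_iff_isNilpotent_maximalIdeal] at h0
  obtain ⟨N, hN⟩ := h0
  refine ⟨N, ?_⟩
  rw [← Ideal.mk_ker (I := I), ← Ideal.map_eq_bot_iff_le_ker, Ideal.map_pow, eq_bot_iff]
  refine (Ideal.pow_right_mono (Ideal.map_le_iff_le_comap.mpr fun x hx ↦ ?_) N).trans hN.le
  rw [Ideal.mem_comap, mem_maximalIdeal, mem_nonunits_iff]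
  intro hu
  obtain ⟨y, hy⟩ := hu.exists_right_inv
  obtain ⟨y, rfl⟩ := Ideal.Quotient.mk_surjective y
  rw [← map_mul, ← map_one (Ideal.Quotient.mk I), Ideal.Quotient.eq] at hy
  have h1 : (1 : S) ∈ maximalIdeal S := by
    have := (Submodule.sub_mem_iff_right _ (Ideal.mul_mem_right y _ hx)).mp (le_maximalIdeal hI hy)
    exact this
  exact (maximalIdeal.isMaximal S).ne_top ((Ideal.eq_top_iff_one _).mpr h1)

lemma dvd_of_dvd_pow_mul {S : Type} [CommRing S] {x y : S} (h : ∀ c, x ∣ y * c → x ∣ c) (k : ℕ) :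
    ∀ c, x ∣ y ^ k * c → x ∣ c := by
  induction k with
  | zero => simp
  | succ k ih => exact fun c hc ↦ h c (ih _ (by rwa [pow_succ, mul_assoc] at hc))

lemma pow_dvd_of_pow_dvd_mul {S : Type} [CommRing S] {x z : S} (hx : IsSMulRegular S x)
    (h : ∀ c, x ∣ z * c → x ∣ c) (k : ℕ) : ∀ c, x ^ k ∣ z * c → x ^ k ∣ c := by
  induction k with
  | zero => simp
  | succ k ih =>
    intro c hc
    obtain ⟨c, rfl⟩ := h c ((dvd_pow_self x k.succ_ne_zero).trans hc)
    obtain ⟨e, he⟩ := hc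
    rw [pow_succ']
    refine mul_dvd_mul_left x (ih c ⟨e, hx ?_⟩)
    simp only [smul_eq_mul]
    linear_combination he

lemma maximalIdeal_le_radical_map {R : Type} [CommRing R] (J p : Ideal R) [p.IsPrime]
    (h : ∀ q : Ideal R, q.IsPrime → q < p → ¬ J ≤ q) :
    maximalIdeal (Localization.AtPrime p) ≤
      (J.map (algebraMap R (Localization.AtPrime p))).radical := by
  rw [Ideal.radical_eq_sInf]
  refine le_sInf fun Q ⟨hJ, hQ⟩ ↦ ?_
  have hle : Q ≤ maximalIdeal _ := le_maximalIdeal hQ.ne_top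
  have hc : Q.under R ≤ p :=
    (Ideal.comap_mono hle).trans_eq
      (IsLocalization.AtPrime.under_maximalIdeal (Localization.AtPrime p) p)
  have heq : Q.under R = p := by
    by_contra hne
    exact h _ (hQ.comap _) (lt_of_le_of_ne hc hne) (Ideal.map_le_iff_le_comap.mp hJ)
  rw [← IsLocalization.map_under p.primeCompl (Localization.AtPrime p) Q, heq,
    Localization.AtPrime.map_eq_maximalIdeal]

theorem ExtVanishes.projective_of_isCMLocal {S : Type} [CommRing S] [IsLocalRing S]
    [IsNoetherianRing S] (hCM : IsCMLocal S) {M : Type} [AddCommGroup M] [Module S M]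
    [Module.Finite S M] (hR : ExtVanishes S M S) (hM : ExtVanishes S M M)
    (hdim : ¬ ringKrullDim S ≤ 1) (hJ : maximalIdeal S ≤ (freeFactorIdeal S M).radical) :
    Module.Projective S M := by
  obtain ⟨d, hd⟩ := exists_natCast_eq_ringKrullDim S
  obtain ⟨rs, hlen, hmem, hreg⟩ := hCM.exists_isRegular hd
  obtain ⟨N, hN⟩ := exists_maximalIdeal_pow_le_of_isRegular hreg (hlen ▸ hd)
  have hd2 : 2 ≤ d := by
    rw [hd] at hdim
    by_contra hlt
    exact hdim (by exact_mod_cast (by omega : d ≤ 1))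
  match rs, hlen, hmem, hreg, hN with
  | [], hlen, _, _, _ => simp at hlen; omega
  | [_], hlen, _, _, _ => simp at hlen; omega
  | x :: y :: rs, hlen, hmem, hreg, hN =>
    obtain ⟨k, hk⟩ := hJ (hmem x (by simp))
    obtain ⟨l, hl⟩ := hJ (hmem y (by simp))
    have hw := hreg.toIsWeaklyRegular
    have hw' := hw
    rw [isWeaklyRegular_cons_iff, isWeaklyRegular_cons_iff] at hw'
    obtain ⟨hx, hy, -⟩ := hw'
    have hxy : ∀ c, x ∣ y * c → x ∣ c := fun c hc ↦ by
      have := mem_of_isSMulRegular_quotient_of_smul_mem hy (x := c)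
      simpa [Submodule.mem_smul_pointwise_iff_exists, dvd_def, eq_comm] using this
        (by simpa [Submodule.mem_smul_pointwise_iff_exists, dvd_def, eq_comm] using hc)
    exact hR.projective_of_isWeaklyRegular [] (x :: y :: rs) hM hw (.nil _ _)
      (Ideal.span_le.mpr hmem) hN (hx.pow k)
      (pow_dvd_of_pow_dvd_mul hx (dvd_of_dvd_pow_mul hxy l) k) hk hl

end CohenMacaulay

/-- Over a Cohen–Macaulay ring, a finitely generated module `M` with
`Ext^{>0}(M, M ⊕ R) = 0` which is locally of finite projective dimension in codimension one
is projective. -/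
theorem projective_of_ext_vanishing_of_loc_finite_pd (R : Type) [CommRing R]
    [IsNoetherianRing R]
    (hCM : ∀ p : PrimeSpectrum R, IsCMLocal (Localization.AtPrime p.asIdeal))
    (M : Type) [AddCommGroup M] [Module R M] [Module.Finite R M]
    (hext : ∀ i : ℕ, 0 < i → Subsingleton (extGroup R i M (M × R)))
    (hMp : ∀ p : PrimeSpectrum R, ringKrullDim (Localization.AtPrime p.asIdeal) ≤ (1 : WithBot ℕ∞) →
      ∃ k : ℕ, hasPdLE (Localization.AtPrime p.asIdeal) k (LocalizedModule p.asIdeal.primeCompl M)) :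
    Module.Projective R M := by
  have hV : ExtVanishes R M (M × R) := fun i ↦
    have := hext (i + 1) i.succ_pos
    subsingleton_abelianExt_of_subsingleton_extGroup _ _ _
  have hM : ExtVanishes R M M :=
    hV.of_retract (LinearMap.inl R M R) (LinearMap.fst R M R) (LinearMap.fst_comp_inl R M R)
  have hR : ExtVanishes R M R :=
    hV.of_retract (LinearMap.inr R M R) (LinearMap.snd R M R) (LinearMap.snd_comp_inr R M R)
  have hfp : Module.FinitePresentation R M := Module.finitePresentation_of_finite R M
  have hloc : ∀ p : Ideal R, ∀ hp : p.IsPrime,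
      Module.Projective (Localization.AtPrime p) (LocalizedModule p.primeCompl M) := by
    intro p
    induction h : p.height using WellFoundedLT.induction generalizing p with
    | ind n ih =>
    subst h
    intro hp
    have hRp := hR.localizedModule_self p.primeCompl
    by_cases hdim : ringKrullDim (Localization.AtPrime p) ≤ 1
    · obtain ⟨k, hk⟩ := hMp ⟨p, hp⟩ hdim
      exact hRp.projective_of_hasPdLE k hk
    · refine hRp.projective_of_isCMLocal (hCM ⟨p, hp⟩) (hM.localizedModule _) hdim ?_
      refine (maximalIdeal_le_radical_map (freeFactorIdeal R M) p fun q hq hqp hle ↦ ?_).trans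
        (Ideal.radical_mono (map_freeFactorIdeal_le _))
      have := ih _ (Ideal.height_strict_mono_of_isPrime_of_isPrime hqp) q rfl hq
      obtain ⟨a, ha, haq⟩ := exists_mem_freeFactorIdeal_notMem (M := M) q
      exact haq (hle ha)
  exact Module.projective_of_localization_maximal fun I hI ↦ hloc I hI.isPrime
end
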